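/- arXiv:0812.4776 — 7 statements merged into one kernel-verified Lean document; each statement's English description precedes it below -/
import Mathlib

section
/- For every n ≥ 1, the complex vector space 𝒫_n has dimension equal to the number of partitions of n. Consequently the generating function Σ_{n≥0} dim 𝒫_n · q^n equals the character ∏_{k≥1} (1 − q^k)^{−1} of the Fock module (Theorem 1 of the paper). -/
open MvPolynomial

/-- The weighted grading on `ℂ[ξ_1,…,ξ_n, η_1,…,η_n]` in which `ξ_j` and `η_j` both have
degree `j` (the variable `ξ_j` is `X (Sum.inl ⟨j-1⟩)`, and `η_j` is `X (Sum.inr ⟨j-1⟩)`). -/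
def wdeg (n : ℕ) : (Fin n ⊕ Fin n) → ℕ :=
  Sum.elim (fun j => j.1 + 1) (fun j => j.1 + 1)

/-- The shifted point `(ξ_j + (−x)^j ; η_j + x^j)` appearing in the kinematic-pole condition. -/
noncomputable def shiftEval (n : ℕ) (x : ℂ) (v : (Fin n ⊕ Fin n) → ℂ) :
    (Fin n ⊕ Fin n) → ℂ :=
  Sum.elim (fun j => v (Sum.inl j) + (-x) ^ (j.1 + 1))
           (fun j => v (Sum.inr j) + x ^ (j.1 + 1))

/-- The subspace of polynomials invariant under all the kinematic-pole shifts. -/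
noncomputable def invSubmodule (n : ℕ) : Submodule ℂ (MvPolynomial (Fin n ⊕ Fin n) ℂ) where
  carrier := {p | ∀ (x : ℂ) (v : (Fin n ⊕ Fin n) → ℂ), eval (shiftEval n x v) p = eval v p}
  add_mem' := by
    intro p q hp hq x v
    simp [map_add, hp x v, hq x v]
  zero_mem' := by
    intro x v
    simp
  smul_mem' := by
    intro c p hp x v
    simp [MvPolynomial.smul_eval, hp x v]

/-- The space `𝒫_n`: weighted-homogeneous polynomials of degree `n` satisfying the
kinematic-pole condition. -/
noncomputable def Pspace (n : ℕ) : Submodule ℂ (MvPolynomial (Fin n ⊕ Fin n) ℂ) :=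
  weightedHomogeneousSubmodule ℂ (wdeg n) n ⊓ invSubmodule n

section Weighted

variable {σ τ R M : Type*} [CommSemiring R] [AddCommMonoid M]

/-- Substituting weighted-homogeneous polynomials of matching weights preserves
weighted homogeneity. -/
theorem MvPolynomial.IsWeightedHomogeneous.aeval_of_forall {w : σ → M} {w' : τ → M}
    {p : MvPolynomial σ R} {m : M} (hp : IsWeightedHomogeneous w p m)
    {f : σ → MvPolynomial τ R} (hf : ∀ i, IsWeightedHomogeneous w' (f i) (w i)) :
    IsWeightedHomogeneous w' (aeval f p) m := by
  rw [aeval_def, eval₂_eq]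
  refine IsWeightedHomogeneous.sum _ _ _ fun d hd => ?_
  have hprod := IsWeightedHomogeneous.prod d.support (fun i => f i ^ d i)
    (fun i => d i • w i) fun i _ => (hf i).pow (d i)
  have hw : ∑ i ∈ d.support, d i • w i = m := by
    simpa [Finsupp.weight_apply, Finsupp.sum] using hp (mem_support_iff.mp hd)
  rw [hw] at hprod
  exact hprod.C_mul _

/-- The dimension of a weighted-homogeneous component is the number of exponents of that weight. -/
theorem finrank_weightedHomogeneousSubmodule (K : Type*) [Field K] (w : σ → M) (m : M) :
    Module.finrank K (weightedHomogeneousSubmodule K w m) =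
      Nat.card {d : σ →₀ ℕ // Finsupp.weight w d = m} := by
  rw [weightedHomogeneousSubmodule_eq_finsupp_supported]
  exact Module.finrank_eq_nat_card_basis (basisRestrictSupport K {d | Finsupp.weight w d = m})

end Weighted

theorem Finsupp.sum_map_toMultiset {σ : Type*} (w : σ → ℕ) (d : σ →₀ ℕ) :
    ((Finsupp.toMultiset d).map w).sum = Finsupp.weight w d := by
  induction d using Finsupp.induction_linear with
  | zero => simp
  | add f g hf hg => simp [hf, hg]
  | single a b =>
    rw [Finsupp.toMultiset_single, Multiset.map_nsmul, Multiset.sum_nsmul]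
    simp [Finsupp.weight_single]

/-- Exponent vectors on `n` variables of weights `1, …, n` and of total weight `n` correspond to
partitions of `n`. -/
theorem card_weight_eq_card_partition (n : ℕ) :
    Nat.card {d : Fin n →₀ ℕ // Finsupp.weight (fun j : Fin n => j.1 + 1) d = n} =
      Fintype.card (Nat.Partition n) := by
  rw [← Nat.card_eq_fintype_card]
  refine Nat.card_eq_of_bijective
    (fun d => ⟨(Finsupp.toMultiset d.1).map fun j => j.1 + 1, ?_, ?_⟩) ⟨?_, ?_⟩
  · intro i hi
    obtain ⟨j, -, rfl⟩ := Multiset.mem_map.mp hi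
    exact Nat.succ_pos _
  · rw [Finsupp.sum_map_toMultiset, d.2]
  · intro d e h
    have hinj : Function.Injective fun j : Fin n => j.1 + 1 := fun a b hab =>
      Fin.ext (Nat.succ_injective hab)
    exact Subtype.ext (Finsupp.orderIsoMultiset.injective
      (Multiset.map_injective hinj (congrArg Nat.Partition.parts h)))
  · intro p
    let s : Multiset (Fin n) := p.parts.attach.map fun m =>
      ⟨m.1 - 1, by have := p.parts_pos m.2; have := Nat.Partition.le_of_mem_parts m.2; omega⟩
    have hs : s.map (fun j => j.1 + 1) = p.parts := by
      rw [Multiset.map_map]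
      conv_rhs => rw [← Multiset.attach_map_val p.parts]
      refine Multiset.map_congr rfl fun m _ => ?_
      exact Nat.sub_add_cancel (p.parts_pos m.2)
    refine ⟨⟨Multiset.toFinsupp s, ?_⟩, ?_⟩
    · rw [← Finsupp.sum_map_toMultiset, Multiset.toFinsupp_toMultiset, hs, p.parts_sum]
    · exact Nat.Partition.ext (by simpa using hs)

/-- The periods of a polynomial function over a field of characteristic zero form a subspace. -/
noncomputable def periodSubmodule {σ K : Type*} [Field K] [CharZero K] (p : MvPolynomial σ K) :
    Submodule K (σ → K) where
  carrier := {c | ∀ v, eval (v + c) p = eval v p}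
  add_mem' := by
    intro a b ha hb v
    rw [← add_assoc, hb, ha]
  zero_mem' := by simp
  smul_mem' := by
    intro t c hc v
    have hnat : ∀ k : ℕ, eval (v + (k : K) • c) p = eval v p := by
      intro k
      induction k with
      | zero => simp
      | succ k ih => rw [Nat.cast_succ, add_smul, one_smul, ← add_assoc, hc, ih]
    let q : Polynomial K :=
      aeval (fun i => Polynomial.C (v i) + Polynomial.X * Polynomial.C (c i)) p
    have hq : ∀ x : K, q.eval x = eval (v + x • c) p := by
      intro x
      rw [← Polynomial.coe_evalRingHom, map_aeval, MvPolynomial.eval]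
      congr 2
      · ext; simp
      · ext; simp; ring
    have hconst : q = Polynomial.C (eval v p) :=
      Polynomial.eq_of_infinite_eval_eq _ _
        ((Set.infinite_range_of_injective (Nat.cast_injective (R := K))).mono (by
          rintro _ ⟨k, rfl⟩
          simp [hq, hnat]))
    rw [← hq, hconst, Polynomial.eval_C]

/-- The moment curve `x ↦ (x, x², …, xⁿ)` spans the whole space. -/
theorem span_range_momentCurve {K : Type*} [Field K] [Infinite K] (n : ℕ) :
    Submodule.span K (Set.range fun (x : K) (j : Fin n) => x ^ (j.1 + 1)) = ⊤ := by
  by_contra hne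
  obtain ⟨f, hf, hle⟩ := Submodule.exists_le_ker_of_lt_top _ (lt_top_iff_ne_top.mpr hne)
  refine hf (LinearMap.pi_ext' fun j => LinearMap.ext_ring ?_)
  let q : Polynomial K :=
    ∑ j : Fin n, Polynomial.monomial (j.1 + 1) (f (Pi.single j 1))
  have hq : q = 0 := by
    refine Polynomial.funext fun x => ?_
    have hx : f (fun j : Fin n => x ^ (j.1 + 1)) = 0 := hle (Submodule.subset_span ⟨x, rfl⟩)
    rw [LinearMap.pi_apply_eq_sum_univ] at hx
    have hsingle (i : Fin n) : (fun j => if i = j then (1 : K) else 0) = Pi.single i 1 := by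
      ext j
      simp [Pi.single_apply, eq_comm]
    simpa [q, Polynomial.eval_finsetSum, mul_comm, hsingle] using hx
  have hj := congrArg (fun r : Polynomial K => r.coeff (j.1 + 1)) hq
  simpa [q, Polynomial.finsetSum_coeff, Polynomial.coeff_monomial, Fin.val_inj] using hj

/-- The direction in which a shift of the `η_j` by `c_j` moves all the variables. -/
noncomputable def shiftDirection (n : ℕ) : (Fin n → ℂ) →ₗ[ℂ] (Fin n ⊕ Fin n → ℂ) where
  toFun c := Sum.elim (fun j => (-1) ^ (j.1 + 1) * c j) c
  map_add' a b := by ext (j | j) <;> simp [mul_add]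
  map_smul' t a := by ext (j | j) <;> simp [mul_left_comm]

theorem shiftEval_eq_add (n : ℕ) (x : ℂ) (v : Fin n ⊕ Fin n → ℂ) :
    shiftEval n x v = v + shiftDirection n fun j => x ^ (j.1 + 1) := by
  ext (j | j)
  · simp [shiftEval, shiftDirection, neg_pow x]
  · simp [shiftEval, shiftDirection]

theorem mem_invSubmodule_iff (n : ℕ) (p : MvPolynomial (Fin n ⊕ Fin n) ℂ) :
    p ∈ invSubmodule n ↔ ∀ c v, eval (v + shiftDirection n c) p = eval v p := by
  constructor
  · intro hp c
    have htop : (⊤ : Submodule ℂ (Fin n → ℂ)) ≤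
        (periodSubmodule p).comap (shiftDirection n) := by
      rw [← span_range_momentCurve, Submodule.span_le]
      rintro _ ⟨x, rfl⟩ v
      rw [← shiftEval_eq_add]
      exact hp x v
    exact htop (Submodule.mem_top (x := c))
  · intro hp x v
    rw [shiftEval_eq_add]
    exact hp _ v

/-- The substitution of the invariant combinations `η_j - (-1)^j ξ_j`. -/
noncomputable def invariantSubst (n : ℕ) :
    MvPolynomial (Fin n) ℂ →ₐ[ℂ] MvPolynomial (Fin n ⊕ Fin n) ℂ :=
  aeval fun j => X (Sum.inr j) - C ((-1) ^ (j.1 + 1)) * X (Sum.inl j)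

/-- The restriction of a polynomial to `ξ = 0`. -/
noncomputable def restrictEta (n : ℕ) :
    MvPolynomial (Fin n ⊕ Fin n) ℂ →ₐ[ℂ] MvPolynomial (Fin n) ℂ :=
  aeval (Sum.elim 0 X)

theorem eval_invariantSubst (n : ℕ) (v : Fin n ⊕ Fin n → ℂ) (q : MvPolynomial (Fin n) ℂ) :
    eval v (invariantSubst n q) =
      eval (fun j => v (Sum.inr j) - (-1) ^ (j.1 + 1) * v (Sum.inl j)) q := by
  rw [invariantSubst, map_aeval, MvPolynomial.eval]
  congr 2
  · ext; simp
  · ext; simp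

theorem eval_restrictEta (n : ℕ) (u : Fin n → ℂ) (p : MvPolynomial (Fin n ⊕ Fin n) ℂ) :
    eval u (restrictEta n p) = eval (Sum.elim 0 u) p := by
  rw [restrictEta, map_aeval, MvPolynomial.eval]
  congr 2
  · ext; simp
  · ext (j | j) <;> simp

theorem restrictEta_invariantSubst (n : ℕ) (q : MvPolynomial (Fin n) ℂ) :
    restrictEta n (invariantSubst n q) = q := by
  refine MvPolynomial.funext fun u => ?_
  simp [eval_restrictEta, eval_invariantSubst]

theorem invariantSubst_mem_invSubmodule (n : ℕ) (q : MvPolynomial (Fin n) ℂ) :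
    invariantSubst n q ∈ invSubmodule n := by
  rw [mem_invSubmodule_iff]
  intro c v
  rw [eval_invariantSubst, eval_invariantSubst]
  congr 2
  ext j
  have hsq : ((-1 : ℂ) ^ (j.1 + 1)) * (-1) ^ (j.1 + 1) = 1 := by
    rw [← mul_pow]; simp
  simp only [shiftDirection, LinearMap.coe_mk, AddHom.coe_mk, Pi.add_apply, Sum.elim_inl,
    Sum.elim_inr]
  linear_combination (-c j) * hsq

theorem invariantSubst_restrictEta {n : ℕ} {p : MvPolynomial (Fin n ⊕ Fin n) ℂ}
    (hp : p ∈ invSubmodule n) : invariantSubst n (restrictEta n p) = p := by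
  refine MvPolynomial.funext fun v => ?_
  rw [eval_invariantSubst, eval_restrictEta,
    ← (mem_invSubmodule_iff n p).mp hp (fun j => -((-1) ^ (j.1 + 1) * v (Sum.inl j))) v]
  congr 2
  ext (j | j)
  · have hsq : ((-1 : ℂ) ^ (j.1 + 1)) * (-1) ^ (j.1 + 1) = 1 := by
      rw [← mul_pow]; simp
    simp only [shiftDirection, LinearMap.coe_mk, AddHom.coe_mk, Pi.add_apply, Sum.elim_inl,
      Pi.zero_apply]
    linear_combination v (Sum.inl j) * hsq
  · simp [shiftDirection, sub_eq_add_neg]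

theorem invariantSubst_mem_Pspace {n : ℕ} {q : MvPolynomial (Fin n) ℂ}
    (hq : q ∈ weightedHomogeneousSubmodule ℂ (fun j : Fin n => j.1 + 1) n) :
    invariantSubst n q ∈ Pspace n := by
  refine ⟨IsWeightedHomogeneous.aeval_of_forall hq fun j => ?_, invariantSubst_mem_invSubmodule n q⟩
  exact (isWeightedHomogeneous_X ℂ (wdeg n) (Sum.inr j)).sub
    ((isWeightedHomogeneous_X ℂ (wdeg n) (Sum.inl j)).C_mul _)

theorem restrictEta_mem_weightedHomogeneousSubmodule {n : ℕ}
    {p : MvPolynomial (Fin n ⊕ Fin n) ℂ} (hp : p ∈ Pspace n) :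
    restrictEta n p ∈ weightedHomogeneousSubmodule ℂ (fun j : Fin n => j.1 + 1) n := by
  refine IsWeightedHomogeneous.aeval_of_forall hp.1 ?_
  rintro (j | j)
  · exact isWeightedHomogeneous_zero ℂ _ _
  · exact isWeightedHomogeneous_X ℂ _ j

/-- Restriction to `ξ = 0` identifies `𝒫_n` with the weighted-homogeneous polynomials of degree
`n` in the `η_j`. -/
noncomputable def PspaceEquiv (n : ℕ) :
    Pspace n ≃ₗ[ℂ] weightedHomogeneousSubmodule ℂ (fun j : Fin n => j.1 + 1) n :=
  LinearEquiv.ofLinearMap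
    ((restrictEta n).toLinearMap.restrict fun _ => restrictEta_mem_weightedHomogeneousSubmodule)
    ((invariantSubst n).toLinearMap.restrict fun _ => invariantSubst_mem_Pspace)
    (LinearMap.ext fun q => Subtype.ext (restrictEta_invariantSubst n q.1))
    (LinearMap.ext fun p => Subtype.ext (invariantSubst_restrictEta p.2.2))

/-- Theorem 1 of the paper: for every `n ≥ 1`, `dim 𝒫_n` equals the number of
partitions of `n`; hence `Σ_n dim 𝒫_n · q^n = ∏_{k≥1} (1 − q^k)^{-1}`. -/
theorem stmt2 (n : ℕ) (hn : 1 ≤ n) :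
    Module.finrank ℂ (Pspace n) = Fintype.card (Nat.Partition n) := by
  rw [(PspaceEquiv n).finrank_eq, finrank_weightedHomogeneousSubmodule,
    card_weight_eq_card_partition]
end

section
/- For every n ≥ 1, the polynomials p_h(ξ; η) = ∏_{m=1}^n (ξ_m − (−1)^m η_m)^{k_m}, indexed by all multiplicity sequences (k_1,…,k_n) of nonnegative integers with Σ_m m·k_m = n (i.e., by all partitions of n), form a basis of the space 𝒫_n. -/
open MvPolynomial

/-- The polynomial `p_h(ξ;η) = ∏_{m=1}^n (ξ_m − (−1)^m η_m)^{k_m}` attached to a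
multiplicity sequence `k` (a part of size `m` is encoded by the index `m-1 : Fin n`). -/
noncomputable def ph (n : ℕ) (k : Fin n → ℕ) : MvPolynomial (Fin n ⊕ Fin n) ℂ :=
  ∏ m : Fin n,
    (X (Sum.inl m) - (-1 : MvPolynomial (Fin n ⊕ Fin n) ℂ) ^ (m.1 + 1) * X (Sum.inr m)) ^ k m

/-- Chain rule for the substitution of univariate polynomials into a multivariate one. -/
theorem derivative_aeval_eq_sum_pderiv {R σ : Type*} [CommSemiring R] [Fintype σ]
    (g : σ → Polynomial R) (q : MvPolynomial σ R) :
    Polynomial.derivative (aeval g q) =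
      ∑ i, aeval g (pderiv i q) * Polynomial.derivative (g i) := by
  classical
  induction q using MvPolynomial.induction_on with
  | C a => simp
  | add p q hp hq => simp [hp, hq, add_mul, Finset.sum_add_distrib]
  | mul_X p j hp =>
    simp only [map_mul, aeval_X, Polynomial.derivative_mul, hp, Derivation.leibniz, pderiv_X,
      smul_eq_mul, map_add, add_mul, Finset.sum_add_distrib, Finset.sum_mul]
    rw [add_comm]
    congr 1
    · rw [Finset.sum_eq_single j]
      · simp
      · intro b _ hb
        simp [Pi.single_eq_of_ne hb.symm]
      · simp
    · exact Finset.sum_congr rfl fun i _ => by ring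

theorem coeff_eq_zero_of_pderiv_eq_zero {R σ : Type*} [CommSemiring R] [NoZeroDivisors R]
    [CharZero R] {q : MvPolynomial σ R} {i : σ} (hq : pderiv i q = 0) {d : σ →₀ ℕ}
    (hd : d i ≠ 0) : coeff d q = 0 := by
  have h := coeff_pderiv (i := i) q (d - Finsupp.single i 1)
  rw [hq, coeff_zero, tsub_add_cancel_of_le
    (Finsupp.single_le_iff.mpr (Nat.one_le_iff_ne_zero.mpr hd))] at h
  exact (mul_eq_zero.mp h.symm).resolve_right (Nat.cast_add_one_ne_zero _)

/-- A substitution that replaces each variable by a weighted-homogeneous polynomial of the same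
weight preserves weighted homogeneity. -/
theorem isWeightedHomogeneous_aeval {R σ τ M : Type*} [CommSemiring R] [AddCommMonoid M]
    {w : σ → M} {w' : τ → M} {g : σ → MvPolynomial τ R}
    (hg : ∀ i, IsWeightedHomogeneous w' (g i) (w i)) {p : MvPolynomial σ R} {m : M}
    (hp : IsWeightedHomogeneous w p m) : IsWeightedHomogeneous w' (aeval g p) m := by
  rw [p.as_sum, map_sum]
  refine IsWeightedHomogeneous.sum _ _ _ fun d hd => ?_
  rw [aeval_monomial, algebraMap_eq]
  refine IsWeightedHomogeneous.C_mul ?_ _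
  rw [← hp (mem_support_iff.mp hd), Finsupp.weight_apply]
  exact IsWeightedHomogeneous.prod _ _ _ fun i _ => (hg i).pow _

/-- The substitution `ξ_m ↦ ξ_m + (−1)^m η_m`, `η_m ↦ η_m`. -/
noncomputable def shearAdd (n : ℕ) :
    MvPolynomial (Fin n ⊕ Fin n) ℂ →ₐ[ℂ] MvPolynomial (Fin n ⊕ Fin n) ℂ :=
  aeval (Sum.elim (fun m => X (Sum.inl m) + (-1) ^ (m.1 + 1) * X (Sum.inr m))
    (fun m => X (Sum.inr m)))

/-- The substitution `ξ_m ↦ ξ_m − (−1)^m η_m`, `η_m ↦ η_m`. -/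
noncomputable def shearSub (n : ℕ) :
    MvPolynomial (Fin n ⊕ Fin n) ℂ →ₐ[ℂ] MvPolynomial (Fin n ⊕ Fin n) ℂ :=
  aeval (Sum.elim (fun m => X (Sum.inl m) - (-1) ^ (m.1 + 1) * X (Sum.inr m))
    (fun m => X (Sum.inr m)))

theorem shearSub_shearAdd (n : ℕ) (p : MvPolynomial (Fin n ⊕ Fin n) ℂ) :
    shearSub n (shearAdd n p) = p := by
  have h : (shearSub n).comp (shearAdd n) = AlgHom.id ℂ _ := by
    ext i
    rcases i with i | i <;> simp [shearSub, shearAdd]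
  exact DFunLike.congr_fun h p

theorem isWeightedHomogeneous_neg_one_pow_mul_X (n : ℕ) (m : Fin n) :
    IsWeightedHomogeneous (wdeg n)
      ((-1 : MvPolynomial (Fin n ⊕ Fin n) ℂ) ^ (m.1 + 1) * X (Sum.inr m)) (m.1 + 1) := by
  have h := (isWeightedHomogeneous_X ℂ (wdeg n) (Sum.inr m)).C_mul ((-1) ^ (m.1 + 1))
  simpa [wdeg] using h

theorem isWeightedHomogeneous_shearAdd {n k : ℕ} {p : MvPolynomial (Fin n ⊕ Fin n) ℂ}
    (hp : IsWeightedHomogeneous (wdeg n) p k) :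
    IsWeightedHomogeneous (wdeg n) (shearAdd n p) k := by
  refine isWeightedHomogeneous_aeval (fun i => ?_) hp
  rcases i with i | i
  · exact (isWeightedHomogeneous_X ℂ (wdeg n) (Sum.inl i)).add
      (isWeightedHomogeneous_neg_one_pow_mul_X n i)
  · exact isWeightedHomogeneous_X ℂ (wdeg n) (Sum.inr i)

theorem eval_shearAdd (n : ℕ) (v : Fin n ⊕ Fin n → ℂ) (p : MvPolynomial (Fin n ⊕ Fin n) ℂ) :
    eval v (shearAdd n p) =
      eval (Sum.elim (fun m => v (Sum.inl m) + (-1) ^ (m.1 + 1) * v (Sum.inr m))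
        (fun m => v (Sum.inr m))) p := by
  have h : ((aeval v).comp (shearAdd n) : MvPolynomial (Fin n ⊕ Fin n) ℂ →ₐ[ℂ] ℂ) =
      aeval (Sum.elim (fun m => v (Sum.inl m) + (-1) ^ (m.1 + 1) * v (Sum.inr m))
        (fun m => v (Sum.inr m))) := by
    ext i
    rcases i with i | i <;> simp [shearAdd]
  simpa using DFunLike.congr_fun h p

/-- After the shear, the kinematic-pole shift only moves the variables `η_j`. -/
theorem eval_shearAdd_shift {n : ℕ} {p : MvPolynomial (Fin n ⊕ Fin n) ℂ}
    (hp : p ∈ invSubmodule n) (x : ℂ) (v : Fin n ⊕ Fin n → ℂ) :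
    eval (Sum.elim (fun j => v (Sum.inl j)) (fun j => v (Sum.inr j) + x ^ (j.1 + 1)))
      (shearAdd n p) = eval v (shearAdd n p) := by
  rw [eval_shearAdd, eval_shearAdd, ← hp x (Sum.elim _ fun m => v (Sum.inr m))]
  congr 2
  funext i
  rcases i with i | i
  · simp only [shiftEval, Sum.elim_inl, Sum.elim_inr]
    rw [neg_pow x]
    ring
  · simp [shiftEval]

theorem pderiv_inr_eq_zero_of_shift_invariant {n : ℕ} {q : MvPolynomial (Fin n ⊕ Fin n) ℂ}
    (hq : ∀ (x : ℂ) (v : Fin n ⊕ Fin n → ℂ),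
      eval (Sum.elim (fun j => v (Sum.inl j)) (fun j => v (Sum.inr j) + x ^ (j.1 + 1))) q =
        eval v q) (j : Fin n) : pderiv (Sum.inr j) q = 0 := by
  refine MvPolynomial.funext fun v => ?_
  rw [map_zero]
  -- differentiate along the moment curve through `u`
  have curve (u : Fin n ⊕ Fin n → ℂ) (x : ℂ) :
      ∑ i : Fin n, eval (Sum.elim (fun j => u (Sum.inl j))
        (fun j => u (Sum.inr j) + x ^ (j.1 + 1))) (pderiv (Sum.inr i) q) *
          ((i.1 + 1 : ℂ) * x ^ i.1) = 0 := by
    let g : Fin n ⊕ Fin n → Polynomial ℂ := Sum.elim (fun j => Polynomial.C (u (Sum.inl j)))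
      (fun j => Polynomial.C (u (Sum.inr j)) + Polynomial.X ^ (j.1 + 1))
    have eval_g (y : ℂ) (r : MvPolynomial (Fin n ⊕ Fin n) ℂ) : (aeval g r).eval y =
        eval (Sum.elim (fun j => u (Sum.inl j)) (fun j => u (Sum.inr j) + y ^ (j.1 + 1))) r := by
      have h : ((Polynomial.aeval y).comp (aeval g) :
          MvPolynomial (Fin n ⊕ Fin n) ℂ →ₐ[ℂ] ℂ) =
          aeval (Sum.elim (fun j => u (Sum.inl j)) (fun j => u (Sum.inr j) + y ^ (j.1 + 1))) := by
        ext i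
        rcases i with i | i <;> simp [g]
      simpa using DFunLike.congr_fun h r
    have const : aeval g q = Polynomial.C (eval u q) :=
      Polynomial.funext fun y => by rw [eval_g, hq, Polynomial.eval_C]
    have h := congrArg (Polynomial.eval x) (derivative_aeval_eq_sum_pderiv g q)
    rw [const, Polynomial.derivative_C, Polynomial.eval_zero, Polynomial.eval_finsetSum] at h
    simpa [eval_g, Fintype.sum_sum_type, g] using h.symm
  have vanish : (∑ i : Fin n, Polynomial.C (eval v (pderiv (Sum.inr i) q) * (i.1 + 1 : ℂ)) *
      Polynomial.X ^ i.1) = 0 := by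
    refine Polynomial.funext fun x => ?_
    have h := curve (Sum.elim (fun j => v (Sum.inl j))
      (fun j => v (Sum.inr j) - x ^ (j.1 + 1))) x
    simp only [Sum.elim_inl, Sum.elim_inr, sub_add_cancel] at h
    rw [show Sum.elim (fun j => v (Sum.inl j)) (fun j => v (Sum.inr j)) = v from
      Sum.elim_comp_inl_inr v] at h
    simpa [Polynomial.eval_finsetSum, mul_assoc] using h
  have h := congrArg (fun r => Polynomial.coeff r j.1) vanish
  simp only [Polynomial.finsetSum_coeff, Polynomial.coeff_C_mul_X_pow, Fin.val_inj,
    Finset.sum_ite_eq, Finset.mem_univ, if_true, Polynomial.coeff_zero] at h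
  exact (mul_eq_zero.mp h).resolve_right (Nat.cast_add_one_ne_zero _)

/-- The exponent vector of the monomial `∏ ξ_m^{k_m}`. -/
noncomputable def inlExponent {n : ℕ} (k : Fin n → ℕ) : Fin n ⊕ Fin n →₀ ℕ :=
  Finsupp.equivFunOnFinite.symm (Sum.elim k 0)

theorem inlExponent_injective (n : ℕ) : Function.Injective (inlExponent (n := n)) := by
  intro k l h
  funext m
  simpa [inlExponent] using DFunLike.congr_fun h (Sum.inl m)

theorem shearSub_monomial_inlExponent {n : ℕ} (k : Fin n → ℕ) (c : ℂ) :
    shearSub n (monomial (inlExponent k) c) = c • ph n k := by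
  rw [shearSub, aeval_monomial, Finsupp.prod_fintype _ _ (by simp), Fintype.prod_sum_type,
    Algebra.smul_def]
  simp [inlExponent, ph]

theorem shearAdd_ph {n : ℕ} (k : Fin n → ℕ) :
    shearAdd n (ph n k) = monomial (inlExponent k) 1 := by
  rw [monomial_eq, Finsupp.prod_fintype _ _ (by simp), Fintype.prod_sum_type]
  simp [inlExponent, ph, shearAdd]

theorem ph_mem_Pspace {n : ℕ} {k : Fin n → ℕ} (hk : ∑ m : Fin n, (m.1 + 1) * k m = n) :
    ph n k ∈ Pspace n := by
  refine ⟨?_, fun x v => ?_⟩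
  · have h := IsWeightedHomogeneous.prod Finset.univ _ _ fun m _ =>
      ((isWeightedHomogeneous_X ℂ (wdeg n) (Sum.inl m)).sub
        (isWeightedHomogeneous_neg_one_pow_mul_X n m)).pow (k m)
    have hsum : ∑ m : Fin n, k m • wdeg n (Sum.inl m) = n := by
      simpa [wdeg, mul_comm] using hk
    rw [hsum] at h
    exact h
  · simp only [ph, map_prod, map_pow, map_sub, map_mul, map_neg, map_one, eval_X, shiftEval,
      Sum.elim_inl, Sum.elim_inr]
    refine Finset.prod_congr rfl fun m _ => ?_
    rw [neg_pow x]
    ring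

theorem linearIndependent_ph (n : ℕ) : LinearIndependent ℂ (ph n) := by
  refine LinearIndependent.of_comp (shearAdd n).toLinearMap ?_
  have h := (basisMonomials (Fin n ⊕ Fin n) ℂ).linearIndependent.comp _ (inlExponent_injective n)
  have hcomp : (shearAdd n).toLinearMap ∘ ph n =
      basisMonomials (Fin n ⊕ Fin n) ℂ ∘ inlExponent := by
    funext k
    simp [shearAdd_ph]
  exact hcomp ▸ h

theorem Pspace_le_span_ph (n : ℕ) :
    Pspace n ≤ Submodule.span ℂ
      (Set.range fun h : {k : Fin n → ℕ // ∑ m : Fin n, (m.1 + 1) * k m = n} => ph n h.1) := by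
  rintro p ⟨hhom, hinv⟩
  have hhom' := isWeightedHomogeneous_shearAdd hhom
  rw [← shearSub_shearAdd n p, (shearAdd n p).as_sum, map_sum]
  refine Submodule.sum_mem _ fun d hd => ?_
  rw [mem_support_iff] at hd
  have hexp : d = inlExponent fun m => d (Sum.inl m) := by
    ext i
    rcases i with i | i
    · simp [inlExponent]
    · by_contra hi
      exact hd (coeff_eq_zero_of_pderiv_eq_zero
        (pderiv_inr_eq_zero_of_shift_invariant (eval_shearAdd_shift hinv) i)
        (by simpa [inlExponent] using hi))
  have hdeg : ∑ m : Fin n, (m.1 + 1) * d (Sum.inl m) = n := by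
    have h := hhom' hd
    rw [hexp, Finsupp.weight_apply, Finsupp.sum_fintype _ _ (by simp),
      Fintype.sum_sum_type] at h
    simpa [inlExponent, wdeg, mul_comm] using h
  rw [hexp, shearSub_monomial_inlExponent]
  exact Submodule.smul_mem _ _ (Submodule.subset_span ⟨⟨_, hdeg⟩, rfl⟩)

/-- for every `n ≥ 1`, the polynomials `p_h`, indexed by all multiplicity
sequences `(k_1,…,k_n)` with `Σ_m m·k_m = n` (partitions of `n`), form a basis of `𝒫_n`:
they lie in `𝒫_n`, are linearly independent, and span `𝒫_n`. -/
theorem stmt3 (n : ℕ) (hn : 1 ≤ n) :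
    (∀ h : {k : Fin n → ℕ // ∑ m : Fin n, (m.1 + 1) * k m = n}, ph n h.1 ∈ Pspace n) ∧
    LinearIndependent ℂ
      (fun h : {k : Fin n → ℕ // ∑ m : Fin n, (m.1 + 1) * k m = n} => ph n h.1) ∧
    Submodule.span ℂ
      (Set.range (fun h : {k : Fin n → ℕ // ∑ m : Fin n, (m.1 + 1) * k m = n} => ph n h.1))
      = Pspace n := by
  refine ⟨fun h => ph_mem_Pspace h.2,
    (linearIndependent_ph n).comp _ Subtype.val_injective,
    le_antisymm (Submodule.span_le.mpr ?_) (Pspace_le_span_ph n)⟩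
  rintro _ ⟨h, rfl⟩
  exact ph_mem_Pspace h.2
end

section
/- For any partition h, any a ∈ ℂ, any N ≥ 2, and any admissible tuple (x_1,…,x_{N−2}, x) with x ∉ {0,1,−1}, the function x' ↦ J^h_{N,a}(x_1,…,x_{N−2}, x, x') (each of whose summands has at most a simple pole at x' = x, coming from the factors f(x/x') or f(x'/x)) has a removable singularity at x' = x; equivalently, lim_{x'→x} (x' − x) · J^h_{N,a}(x_1,…,x_{N−2}, x, x') = 0. -/
open Finset Filter Complex

/-- The function `f(x) = (x+ω)(x−ω⁻¹)/(x²−1)`. -/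
noncomputable def ff (ω x : ℂ) : ℂ := (x + ω) * (x - ω⁻¹) / (x ^ 2 - 1)

/-- The power sum `S_m` (with `m ∈ ℤ`) of the entries `X i`, `i ∈ I`. -/
noncomputable def pS (m : ℤ) {N : ℕ} (X : Fin N → ℂ) (I : Finset (Fin N)) : ℂ :=
  ∑ i ∈ I, X i ^ m

/-- The polynomial `P^h(X_-|X_+) = ∏_{m=1}^s (S_m(X_-) − (−1)^m S_m(X_+))^{k_m}` of the
partition `h` with multiplicities `k` (with `k m` parts equal to `m`, `1 ≤ m ≤ s`),
evaluated on the entries of `X` indexed by `Im` and `Ip`. -/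
noncomputable def Ph (k : ℕ → ℕ) (s : ℕ) {N : ℕ} (X : Fin N → ℂ)
    (Im Ip : Finset (Fin N)) : ℂ :=
  ∏ m ∈ Finset.Icc 1 s, (pS (m : ℤ) X Im - (-1 : ℂ) ^ m * pS (m : ℤ) X Ip) ^ k m

/-- A tuple is admissible if all entries are nonzero and `x_i ≠ ±x_j` for `i ≠ j`. -/
def Admissible {N : ℕ} (X : Fin N → ℂ) : Prop :=
  (∀ i, X i ≠ 0) ∧ ∀ i j, i ≠ j → X i ≠ X j ∧ X i ≠ -X j

/-- The phase factor `e^{iπa(#I_- − #I_+)}` where `#I_- = c`, `#I_+ = N − c`. -/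
noncomputable def phase (a : ℂ) (N c : ℕ) : ℂ :=
  Complex.exp (Complex.I * (Real.pi : ℂ) * a * (2 * (c : ℂ) - (N : ℂ)))

/-- The descendant function
`J^h_{N,a}(X) = Σ_{I_- ⊔ I_+} e^{iπa(#I_- − #I_+)} P^h(X_-|X_+) ∏_{i∈I_-, j∈I_+} f(x_i/x_j)`. -/
noncomputable def J (ω : ℂ) (k : ℕ → ℕ) (s : ℕ) (a : ℂ) {N : ℕ} (X : Fin N → ℂ) : ℂ :=
  ∑ I : Finset (Fin N),
    phase a N I.card * Ph k s X I Iᶜ * ∏ i ∈ I, ∏ j ∈ Iᶜ, ff ω (X i / X j)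

/-- The exponential-field function `J_{N,a}(X)` (the case `P^h = 1`). -/
noncomputable def Jexp (ω a : ℂ) {N : ℕ} (X : Fin N → ℂ) : ℂ :=
  ∑ I : Finset (Fin N),
    phase a N I.card * ∏ i ∈ I, ∏ j ∈ Iᶜ, ff ω (X i / X j)

/-- `ff ω` with the value at the pole `1` replaced by `1`. -/
noncomputable def ffReg (ω u : ℂ) : ℂ := if u = 1 then 1 else ff ω u

theorem sq_ne_sq_of_snoc_snoc {M : ℕ} {X : Fin M → ℂ} {x : ℂ}
    (hadm : Admissible (Fin.snoc X x : Fin (M + 1) → ℂ)) {i j : Fin (M + 2)} (hij : i ≠ j)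
    (h₁ : ¬(i = (Fin.last M).castSucc ∧ j = Fin.last (M + 1)))
    (h₂ : ¬(i = Fin.last (M + 1) ∧ j = (Fin.last M).castSucc)) :
    (Fin.snoc (Fin.snoc X x : Fin (M + 1) → ℂ) x : Fin (M + 2) → ℂ) i ^ 2 ≠
      (Fin.snoc (Fin.snoc X x : Fin (M + 1) → ℂ) x : Fin (M + 2) → ℂ) j ^ 2 := by
  have key : ∀ i j : Fin (M + 1), i ≠ j →
      (Fin.snoc X x : Fin (M + 1) → ℂ) i ^ 2 ≠ (Fin.snoc X x : Fin (M + 1) → ℂ) j ^ 2 := by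
    intro i j h hsq
    rcases sq_eq_sq_iff_eq_or_eq_neg.1 hsq with h' | h'
    · exact (hadm.2 i j h).1 h'
    · exact (hadm.2 i j h).2 h'
  have hlast : (Fin.snoc X x : Fin (M + 1) → ℂ) (Fin.last M) = x := Fin.snoc_last _ _
  induction i using Fin.lastCases with
  | last =>
    induction j using Fin.lastCases with
    | last => exact absurd rfl hij
    | cast j =>
      rw [Fin.snoc_last, Fin.snoc_castSucc]
      have := key (Fin.last M) j (fun h => h₂ ⟨rfl, by rw [h]⟩)
      rwa [hlast] at this
  | cast i =>
    induction j using Fin.lastCases with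
    | last =>
      rw [Fin.snoc_last, Fin.snoc_castSucc]
      have := key i (Fin.last M) (fun h => h₁ ⟨by rw [h], rfl⟩)
      rwa [hlast] at this
    | cast j =>
      rw [Fin.snoc_castSucc, Fin.snoc_castSucc]
      exact key i j (fun h => hij (by rw [h]))

theorem snoc_ne_zero {N : ℕ} {X : Fin N → ℂ} {x : ℂ} (hX : ∀ i, X i ≠ 0) (hx : x ≠ 0)
    (i : Fin (N + 1)) : (Fin.snoc X x : Fin (N + 1) → ℂ) i ≠ 0 := by
  induction i using Fin.lastCases with
  | last => rwa [Fin.snoc_last]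
  | cast i => rw [Fin.snoc_castSucc]; exact hX i

theorem continuous_snoc_apply {N : ℕ} (X : Fin N → ℂ) (i : Fin (N + 1)) :
    Continuous fun y : ℂ => (Fin.snoc X y : Fin (N + 1) → ℂ) i := by
  induction i using Fin.lastCases with
  | last => simpa only [Fin.snoc_last] using continuous_id'
  | cast i => simpa only [Fin.snoc_castSucc] using continuous_const

theorem continuousAt_ff {ω u : ℂ} (hu : u ^ 2 ≠ 1) : ContinuousAt (ff ω) u := by
  unfold ff
  exact ContinuousAt.div (by fun_prop) (by fun_prop) (sub_ne_zero.2 hu)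

theorem continuous_Ph_snoc (k : ℕ → ℕ) (s : ℕ) {N : ℕ} (X : Fin N → ℂ)
    (A B : Finset (Fin (N + 1))) : Continuous fun y : ℂ => Ph k s (Fin.snoc X y) A B := by
  unfold Ph pS
  simp only [zpow_natCast]
  have := continuous_snoc_apply X
  fun_prop

/-- The factor attached to a pair of distinct indices other than the last two is regular. -/
theorem tendsto_ff_snoc_snoc (ω : ℂ) {M : ℕ} {X : Fin M → ℂ} {x : ℂ} (hx0 : x ≠ 0)
    (hadm : Admissible (Fin.snoc X x : Fin (M + 1) → ℂ)) {i j : Fin (M + 2)} (hij : i ≠ j)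
    (h₁ : ¬(i = (Fin.last M).castSucc ∧ j = Fin.last (M + 1)))
    (h₂ : ¬(i = Fin.last (M + 1) ∧ j = (Fin.last M).castSucc)) :
    Tendsto (fun y : ℂ => ff ω ((Fin.snoc (Fin.snoc X x : Fin (M + 1) → ℂ) y :
        Fin (M + 2) → ℂ) i / (Fin.snoc (Fin.snoc X x : Fin (M + 1) → ℂ) y : Fin (M + 2) → ℂ) j))
      (nhdsWithin x {x}ᶜ)
      (nhds (ffReg ω ((Fin.snoc (Fin.snoc X x : Fin (M + 1) → ℂ) x : Fin (M + 2) → ℂ) i /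
        (Fin.snoc (Fin.snoc X x : Fin (M + 1) → ℂ) x : Fin (M + 2) → ℂ) j))) := by
  have hj := snoc_ne_zero hadm.1 hx0 j
  have hsq := sq_ne_sq_of_snoc_snoc hadm hij h₁ h₂
  have hu : ((Fin.snoc (Fin.snoc X x : Fin (M + 1) → ℂ) x : Fin (M + 2) → ℂ) i /
      (Fin.snoc (Fin.snoc X x : Fin (M + 1) → ℂ) x : Fin (M + 2) → ℂ) j) ^ 2 ≠ 1 := by
    rw [div_pow]
    intro h
    exact hsq ((div_eq_one_iff_eq (pow_ne_zero 2 hj)).1 h)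
  rw [ffReg, if_neg (fun h => hu (by rw [h, one_pow]))]
  have hc := ((continuous_snoc_apply (Fin.snoc X x : Fin (M + 1) → ℂ) i).continuousAt (x := x)).div
    (continuous_snoc_apply (Fin.snoc X x : Fin (M + 1) → ℂ) j).continuousAt hj
  exact (ContinuousAt.comp (f := fun y : ℂ =>
    (Fin.snoc (Fin.snoc X x : Fin (M + 1) → ℂ) y : Fin (M + 2) → ℂ) i /
      (Fin.snoc (Fin.snoc X x : Fin (M + 1) → ℂ) y : Fin (M + 2) → ℂ) j)
    (continuousAt_ff hu) hc).tendsto.mono_left nhdsWithin_le_nhds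

theorem tendsto_sub_mul_ff_div_left (ω : ℂ) {x : ℂ} (hx : x ≠ 0) :
    Tendsto (fun y : ℂ => (y - x) * ff ω (y / x)) (nhdsWithin x {x}ᶜ)
      (nhds (x / 2 * ((1 + ω) * (1 - ω⁻¹)))) := by
  have hc : ContinuousAt (fun y : ℂ => x ^ 2 / (y + x) * ((y / x + ω) * (y / x - ω⁻¹))) x := by
    exact ContinuousAt.mul (ContinuousAt.div (by fun_prop) (by fun_prop)
      (by simpa [← two_mul] using hx)) (by fun_prop)
  have hval : x ^ 2 / (x + x) * ((x / x + ω) * (x / x - ω⁻¹)) =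
      x / 2 * ((1 + ω) * (1 - ω⁻¹)) := by
    rw [div_self hx, ← two_mul]
    congr 1
    field_simp
  have ht := hc.tendsto.mono_left (nhdsWithin_le_nhds (s := {x}ᶜ))
  rw [hval] at ht
  have hneg : ∀ᶠ y in nhdsWithin x {x}ᶜ, y + x ≠ 0 := by
    refine nhdsWithin_le_nhds ?_
    have : ContinuousAt (fun y : ℂ => y + x) x := by fun_prop
    exact this.eventually_ne (by simpa [← two_mul] using hx)
  refine ht.congr' ?_
  filter_upwards [hneg, self_mem_nhdsWithin] with y hy hyx
  have hyx' : y - x ≠ 0 := sub_ne_zero.2 hyx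
  have hd : (y / x) ^ 2 - 1 = (y - x) * (y + x) / x ^ 2 := by
    field_simp
    ring
  rw [ff, hd]
  field_simp

theorem tendsto_sub_mul_ff_div_right (ω : ℂ) {x : ℂ} (hx : x ≠ 0) :
    Tendsto (fun y : ℂ => (y - x) * ff ω (x / y)) (nhdsWithin x {x}ᶜ)
      (nhds (-(x / 2 * ((1 + ω) * (1 - ω⁻¹))))) := by
  have hc : ContinuousAt (fun y : ℂ => -(y ^ 2 / (y + x) * ((x / y + ω) * (x / y - ω⁻¹)))) x := by
    have h1 : ContinuousAt (fun y : ℂ => x / y) x := continuousAt_const.div continuousAt_id hx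
    have h2 : ContinuousAt (fun y : ℂ => y ^ 2 / (y + x)) x :=
      ContinuousAt.div (by fun_prop) (by fun_prop) (by simpa [← two_mul] using hx)
    fun_prop
  have hval : -(x ^ 2 / (x + x) * ((x / x + ω) * (x / x - ω⁻¹))) =
      -(x / 2 * ((1 + ω) * (1 - ω⁻¹))) := by
    rw [div_self hx, ← two_mul]
    congr 2
    field_simp
  have ht := hc.tendsto.mono_left (nhdsWithin_le_nhds (s := {x}ᶜ))
  rw [hval] at ht
  have hneg : ∀ᶠ y in nhdsWithin x {x}ᶜ, y + x ≠ 0 ∧ y ≠ 0 := by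
    refine nhdsWithin_le_nhds ?_
    have : ContinuousAt (fun y : ℂ => y + x) x := by fun_prop
    exact (this.eventually_ne (by simpa [← two_mul] using hx)).and
      (continuousAt_id.eventually_ne hx)
  refine ht.congr' ?_
  filter_upwards [hneg, self_mem_nhdsWithin] with y hy hyx
  obtain ⟨hy, hy0⟩ := hy
  have hyx' : y - x ≠ 0 := sub_ne_zero.2 hyx
  have hd : (x / y) ^ 2 - 1 = -((y - x) * (y + x) / y ^ 2) := by
    field_simp
    ring
  rw [ff, hd]
  field_simp

theorem tendsto_sub_mul_prod_of_regular {ι : Type*} {F : ι → ℂ → ℂ} {G : ι → ℂ}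
    {S : Finset ι} {x : ℂ} (h : ∀ q ∈ S, Tendsto (F q) (nhdsWithin x {x}ᶜ) (nhds (G q))) :
    Tendsto (fun y => (y - x) * ∏ q ∈ S, F q y) (nhdsWithin x {x}ᶜ) (nhds 0) := by
  have h0 : Tendsto (fun y : ℂ => y - x) (nhdsWithin x {x}ᶜ) (nhds 0) := by
    have : ContinuousAt (fun y : ℂ => y - x) x := by fun_prop
    simpa using this.tendsto.mono_left (nhdsWithin_le_nhds (s := {x}ᶜ))
  simpa using h0.mul (tendsto_finsetProd S h)

theorem tendsto_sub_mul_prod_of_pole {ι : Type*} [DecidableEq ι] {F : ι → ℂ → ℂ} {G : ι → ℂ}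
    {S : Finset ι} {x c : ℂ} {q₀ : ι} (hq₀ : q₀ ∈ S) (hG : G q₀ = 1)
    (hF : Tendsto (fun y => (y - x) * F q₀ y) (nhdsWithin x {x}ᶜ) (nhds c))
    (h : ∀ q ∈ S, q ≠ q₀ → Tendsto (F q) (nhdsWithin x {x}ᶜ) (nhds (G q))) :
    Tendsto (fun y => (y - x) * ∏ q ∈ S, F q y) (nhdsWithin x {x}ᶜ)
      (nhds (c * ∏ q ∈ S, G q)) := by
  have ht := hF.mul (tendsto_finsetProd (S.erase q₀)
    fun q hq => h q (mem_of_mem_erase hq) (ne_of_mem_erase hq))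
  rw [← mul_prod_erase S G hq₀, hG, one_mul]
  refine ht.congr fun y => ?_
  rw [← mul_prod_erase S (fun q => F q y) hq₀, mul_assoc]

/-- The residue at `y = x` of the factor coupling the indices `p` and `l`, which depends on which
of them lies in `I`. -/
noncomputable def pairResidue (ω x : ℂ) {N : ℕ} (p l : Fin N) (I : Finset (Fin N)) : ℂ :=
  if p ∈ I then if l ∈ I then 0 else -(x / 2 * ((1 + ω) * (1 - ω⁻¹)))
  else if l ∈ I then x / 2 * ((1 + ω) * (1 - ω⁻¹)) else 0

/-- Only the pairs `(p, l)` and `(l, p)` carry a pole, and at most one of them lies in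
`I ×ˢ Iᶜ`. -/
theorem tendsto_sub_mul_prod_pairs {ω x : ℂ} {N : ℕ} {p l : Fin N}
    {F : Fin N × Fin N → ℂ → ℂ} {G : Fin N × Fin N → ℂ}
    (hGpl : G (p, l) = 1) (hGlp : G (l, p) = 1)
    (hpl : Tendsto (fun y => (y - x) * F (p, l) y) (nhdsWithin x {x}ᶜ)
      (nhds (-(x / 2 * ((1 + ω) * (1 - ω⁻¹))))))
    (hlp : Tendsto (fun y => (y - x) * F (l, p) y) (nhdsWithin x {x}ᶜ)
      (nhds (x / 2 * ((1 + ω) * (1 - ω⁻¹)))))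
    (hreg : ∀ q, q.1 ≠ q.2 → q ≠ (p, l) → q ≠ (l, p) →
      Tendsto (F q) (nhdsWithin x {x}ᶜ) (nhds (G q)))
    (I : Finset (Fin N)) :
    Tendsto (fun y : ℂ => (y - x) * ∏ q ∈ I ×ˢ Iᶜ, F q y) (nhdsWithin x {x}ᶜ)
      (nhds (pairResidue ω x p l I * ∏ q ∈ I ×ˢ Iᶜ, G q)) := by
  have hmem : ∀ q ∈ I ×ˢ Iᶜ, q.1 ∈ I ∧ q.2 ∉ I := fun q hq => by simpa using hq
  have hne : ∀ q ∈ I ×ˢ Iᶜ, q.1 ≠ q.2 := fun q hq h => (hmem q hq).2 (h ▸ (hmem q hq).1)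
  by_cases hp : p ∈ I <;> by_cases hl : l ∈ I <;>
    simp only [pairResidue, hp, hl, if_true, if_false, zero_mul]
  · refine tendsto_sub_mul_prod_of_regular fun q hq => hreg q (hne q hq) ?_ ?_
    · rintro rfl
      exact (hmem _ hq).2 hl
    · rintro rfl
      exact (hmem _ hq).2 hp
  · refine tendsto_sub_mul_prod_of_pole (by simp [hp, hl]) hGpl hpl fun q hq hq₀ =>
      hreg q (hne q hq) hq₀ ?_
    rintro rfl
    exact hl (hmem _ hq).1
  · refine tendsto_sub_mul_prod_of_pole (by simp [hp, hl]) hGlp hlp fun q hq hq₀ =>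
      hreg q (hne q hq) ?_ hq₀
    rintro rfl
    exact hp (hmem _ hq).1
  · refine tendsto_sub_mul_prod_of_regular fun q hq => hreg q (hne q hq) ?_ ?_
    · rintro rfl
      exact hp (hmem _ hq).1
    · rintro rfl
      exact hl (hmem _ hq).1

theorem tendsto_sub_mul_prod_ff (ω : ℂ) {M : ℕ} {X : Fin M → ℂ} {x : ℂ} (hx0 : x ≠ 0)
    (hadm : Admissible (Fin.snoc X x : Fin (M + 1) → ℂ)) (I : Finset (Fin (M + 2))) :
    Tendsto (fun y : ℂ => (y - x) * ∏ q ∈ I ×ˢ Iᶜ,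
        ff ω ((Fin.snoc (Fin.snoc X x : Fin (M + 1) → ℂ) y : Fin (M + 2) → ℂ) q.1 /
          (Fin.snoc (Fin.snoc X x : Fin (M + 1) → ℂ) y : Fin (M + 2) → ℂ) q.2))
      (nhdsWithin x {x}ᶜ)
      (nhds (pairResidue ω x (Fin.last M).castSucc (Fin.last (M + 1)) I * ∏ q ∈ I ×ˢ Iᶜ,
        ffReg ω ((Fin.snoc (Fin.snoc X x : Fin (M + 1) → ℂ) x : Fin (M + 2) → ℂ) q.1 /
          (Fin.snoc (Fin.snoc X x : Fin (M + 1) → ℂ) x : Fin (M + 2) → ℂ) q.2))) := by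
  refine tendsto_sub_mul_prod_pairs
    (F := fun q y => ff ω ((Fin.snoc (Fin.snoc X x : Fin (M + 1) → ℂ) y : Fin (M + 2) → ℂ) q.1 /
      (Fin.snoc (Fin.snoc X x : Fin (M + 1) → ℂ) y : Fin (M + 2) → ℂ) q.2))
    (G := fun q => ffReg ω ((Fin.snoc (Fin.snoc X x : Fin (M + 1) → ℂ) x : Fin (M + 2) → ℂ) q.1 /
      (Fin.snoc (Fin.snoc X x : Fin (M + 1) → ℂ) x : Fin (M + 2) → ℂ) q.2)) ?_ ?_ ?_ ?_ ?_ I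
  · simp only [Fin.snoc_castSucc, Fin.snoc_last, div_self hx0, ffReg, if_true]
  · simp only [Fin.snoc_castSucc, Fin.snoc_last, div_self hx0, ffReg, if_true]
  · simpa only [Fin.snoc_castSucc, Fin.snoc_last] using tendsto_sub_mul_ff_div_right ω hx0
  · simpa only [Fin.snoc_castSucc, Fin.snoc_last] using tendsto_sub_mul_ff_div_left ω hx0
  · exact fun q hq h₁ h₂ => tendsto_ff_snoc_snoc ω hx0 hadm hq
      (fun h => h₁ (Prod.ext h.1 h.2)) (fun h => h₂ (Prod.ext h.1 h.2))

/-- If two entries of `Y` agree, the residues of the subsets exchanged by the corresponding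
transposition cancel. -/
theorem sum_residue_eq_zero (ω x a : ℂ) (k : ℕ → ℕ) (s : ℕ) {N : ℕ} (Y : Fin N → ℂ) {p l : Fin N}
    (hY : Y p = Y l) :
    ∑ I : Finset (Fin N), phase a N I.card * Ph k s Y I Iᶜ *
      (pairResidue ω x p l I * ∏ q ∈ I ×ˢ Iᶜ, ffReg ω (Y q.1 / Y q.2)) = 0 := by
  have hswap : ∀ i, Y (Equiv.swap p l i) = Y i := by
    intro i
    rw [Equiv.swap_apply_def]
    split_ifs with h₁ h₂
    · rw [h₁, hY]
    · rw [h₂, hY]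
    · rfl
  have hcompl : ∀ I : Finset (Fin N), (I.map (Equiv.swap p l).toEmbedding)ᶜ =
      Iᶜ.map (Equiv.swap p l).toEmbedding := by
    intro I
    ext i
    simp [mem_map_equiv]
  rw [← self_eq_neg, ← sum_neg_distrib]
  refine Fintype.sum_equiv (Equiv.swap p l).finsetCongr _ _ fun I => ?_
  have hres : pairResidue ω x p l (I.map (Equiv.swap p l).toEmbedding) =
      -pairResidue ω x p l I := by
    simp only [pairResidue, mem_map_equiv, Equiv.symm_swap, Equiv.swap_apply_left,
      Equiv.swap_apply_right]
    split_ifs <;> simp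
  simp only [Equiv.finsetCongr_apply, hcompl, card_map, hres, Ph, pS, sum_map, prod_product,
    prod_map, Equiv.coe_toEmbedding, hswap]
  ring

/-- for any partition `h`, any `a`, and any admissible tuple
`(x_1,…,x_{N−2}, x)` with `x ∉ {0,1,−1}`, the function
`x' ↦ J^h_{N,a}(x_1,…,x_{N−2}, x, x')` has a removable singularity at `x' = x`:
`lim_{x'→x} (x' − x) · J^h_{N,a}(x_1,…,x_{N−2}, x, x') = 0`. -/
theorem stmt4 (ω : ℂ) (hω : ω ≠ 0 ∧ ω ≠ 1 ∧ ω ≠ -1)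
    (k : ℕ → ℕ) (s : ℕ) (a : ℂ) (M : ℕ) (X : Fin M → ℂ) (x : ℂ)
    (hx0 : x ≠ 0) (hx1 : x ≠ 1) (hxm1 : x ≠ -1)
    (hadm : Admissible (Fin.snoc X x)) :
    Filter.Tendsto (fun x' : ℂ => (x' - x) * J ω k s a (Fin.snoc (Fin.snoc X x) x'))
      (nhdsWithin x {x}ᶜ) (nhds 0) := by
  have ht := tendsto_finsetSum (univ : Finset (Finset (Fin (M + 2)))) fun I _ =>
    (((continuous_Ph_snoc k s (Fin.snoc X x : Fin (M + 1) → ℂ) I Iᶜ).tendsto x).mono_left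
      (nhdsWithin_le_nhds (s := {x}ᶜ)) |>.const_mul (phase a (M + 2) I.card)).mul
        (tendsto_sub_mul_prod_ff ω hx0 hadm I)
  rw [sum_residue_eq_zero ω x a k s _ (by simp only [Fin.snoc_castSucc, Fin.snoc_last])] at ht
  refine ht.congr fun y => ?_
  rw [J, mul_sum]
  refine sum_congr rfl fun I _ => ?_
  rw [prod_product]
  ring
end

section
/- For any partition h, any a ∈ ℂ, any N ≥ 2, and any admissible tuple (x_1,…,x_{N−2}, x), the residue of J^h_{N,a} at the kinematic pole x' = −x is given by: lim_{x'→−x} (x' + x) · J^h_{N,a}(x_1,…,x_{N−2}, x, x') = i·x·sin πp · ( ∏_{i=1}^{N−2} f(x_i/x) − ∏_{i=1}^{N−2} f(x/x_i) ) · J^h_{N−2,a}(x_1,…,x_{N−2}). -/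
open Finset Filter Complex

/-- The copy in `Fin (n + 1)` of a subset of `Fin n`, not containing the last index. -/
def liftSet {n : ℕ} (I : Finset (Fin n)) : Finset (Fin (n + 1)) := I.map Fin.castSuccEmb

theorem last_notMem_liftSet {n : ℕ} (I : Finset (Fin n)) : Fin.last n ∉ liftSet I := by
  simp [liftSet]

/-- The copy in `Fin (n + 1)` of a subset of `Fin n`, with the last index added. -/
def liftSetLast {n : ℕ} (I : Finset (Fin n)) : Finset (Fin (n + 1)) :=
  cons (Fin.last n) (liftSet I) (last_notMem_liftSet I)

theorem compl_liftSet {n : ℕ} (I : Finset (Fin n)) : (liftSet I)ᶜ = liftSetLast Iᶜ := by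
  ext i
  refine Fin.lastCases ?_ (fun i => ?_) i <;> simp [liftSet, liftSetLast]

theorem compl_liftSetLast {n : ℕ} (I : Finset (Fin n)) : (liftSetLast I)ᶜ = liftSet Iᶜ := by
  rw [compl_eq_comm, compl_liftSet, compl_compl]

theorem card_liftSet {n : ℕ} (I : Finset (Fin n)) : (liftSet I).card = I.card := by
  simp [liftSet]

theorem card_liftSetLast {n : ℕ} (I : Finset (Fin n)) : (liftSetLast I).card = I.card + 1 := by
  simp [liftSetLast, liftSet]

theorem prod_liftSet {n : ℕ} (I : Finset (Fin n)) (g : Fin (n + 1) → ℂ) :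
    ∏ i ∈ liftSet I, g i = ∏ i ∈ I, g i.castSucc := by
  simp [liftSet]

theorem prod_liftSetLast {n : ℕ} (I : Finset (Fin n)) (g : Fin (n + 1) → ℂ) :
    ∏ i ∈ liftSetLast I, g i = g (Fin.last n) * ∏ i ∈ I, g i.castSucc := by
  simp [liftSetLast, liftSet]

theorem pS_liftSet (m : ℤ) {n : ℕ} (X : Fin n → ℂ) (x : ℂ) (I : Finset (Fin n)) :
    pS m (Fin.snoc X x : Fin (n + 1) → ℂ) (liftSet I) = pS m X I := by
  simp [pS, liftSet]

theorem pS_liftSetLast (m : ℤ) {n : ℕ} (X : Fin n → ℂ) (x : ℂ) (I : Finset (Fin n)) :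
    pS m (Fin.snoc X x : Fin (n + 1) → ℂ) (liftSetLast I) = x ^ m + pS m X I := by
  simp [pS, liftSetLast, liftSet]

/-- A sum over the subsets of `Fin (n + 1)`, split by whether the last index belongs to them. -/
theorem sum_finset_fin_succ {n : ℕ} (F : Finset (Fin (n + 1)) → ℂ) :
    ∑ I, F I = ∑ I : Finset (Fin n), (F (liftSet I) + F (liftSetLast I)) := by
  have hpow : (univ.map Fin.castSuccEmb : Finset (Fin (n + 1))).powerset =
      (univ : Finset (Finset (Fin n))).map (mapEmbedding Fin.castSuccEmb).toEmbedding := by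
    ext I
    simp only [mem_powerset, Finset.mem_map, mem_univ, true_and, subset_map_iff]
    constructor
    · rintro ⟨u, -, rfl⟩
      exact ⟨u, rfl⟩
    · rintro ⟨u, rfl⟩
      exact ⟨u, subset_univ _, rfl⟩
  have hlast : Fin.last n ∉ (univ.map Fin.castSuccEmb : Finset (Fin (n + 1))) :=
    last_notMem_liftSet univ
  rw [← powerset_univ, Fin.univ_castSuccEmb, cons_eq_insert, sum_powerset_insert hlast, hpow,
    sum_map, sum_map, ← sum_add_distrib]
  simp [liftSetLast, liftSet, mapEmbedding_apply]

theorem ff_neg_inv {ω : ℂ} (hω : ω ≠ 0) {z : ℂ} (hz : z ≠ 0) : ff ω (-z⁻¹) = ff ω z := by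
  unfold ff
  by_cases h : z ^ 2 - 1 = 0
  · have : (-z⁻¹) ^ 2 - 1 = 0 := by
      field_simp
      linear_combination -h
    rw [h, this, div_zero, div_zero]
  · have : (-z⁻¹) ^ 2 - 1 ≠ 0 := by
      intro h'
      field_simp at h'
      exact h (by linear_combination -h')
    rw [div_eq_div_iff this h]
    field_simp
    ring

theorem ff_neg_div {ω : ℂ} (hω : ω ≠ 0) {y z : ℂ} (hy : y ≠ 0) (hz : z ≠ 0) :
    ff ω (-y / z) = ff ω (z / y) := by
  rw [← ff_neg_inv hω (div_ne_zero hz hy), inv_div, neg_div]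

theorem ff_div_neg {ω : ℂ} (hω : ω ≠ 0) {y z : ℂ} (hy : y ≠ 0) (hz : z ≠ 0) :
    ff ω (y / -z) = ff ω (z / y) := by
  rw [← ff_neg_div hω hy hz, neg_div, div_neg]

theorem continuousAt_ff_s5 (ω : ℂ) {z : ℂ} (hz : z ^ 2 ≠ 1) : ContinuousAt (ff ω) z := by
  unfold ff
  exact ContinuousAt.div (by fun_prop) (by fun_prop) (sub_ne_zero.mpr hz)

theorem div_sq_ne_one {y z : ℂ} (hz : z ≠ 0) (h : y ≠ z) (h' : y ≠ -z) : (y / z) ^ 2 ≠ 1 := by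
  rw [div_pow, Ne, div_eq_one_iff_eq (pow_ne_zero 2 hz), sq_eq_sq_iff_eq_or_eq_neg]
  tauto

/-- The residue at `y = -x` of `y ↦ f(y / x)`. -/
theorem tendsto_mul_ff_div (ω : ℂ) (hω : ω ≠ 0) {x : ℂ} (hx : x ≠ 0) :
    Tendsto (fun y : ℂ => (y + x) * ff ω (y / x)) (nhdsWithin (-x) {-x}ᶜ)
      (nhds (x * ((ω - ω⁻¹) / 2))) := by
  have hc : ContinuousAt (fun y : ℂ => x ^ 2 * (y / x + ω) * (y / x - ω⁻¹) / (y - x)) (-x) := by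
    refine ContinuousAt.div (by fun_prop) (by fun_prop) ?_
    intro h
    exact hx (by linear_combination (-1 / 2 : ℂ) * h)
  have hval : x ^ 2 * (-x / x + ω) * (-x / x - ω⁻¹) / (-x - x) = x * ((ω - ω⁻¹) / 2) := by
    have h2 : -x - x = -(2 * x) := by ring
    rw [h2]
    field_simp
    ring
  rw [← hval]
  refine (hc.tendsto.mono_left nhdsWithin_le_nhds).congr' ?_
  filter_upwards [self_mem_nhdsWithin] with y hy
  have h1 : y + x ≠ 0 := fun h => hy (eq_neg_of_add_eq_zero_left h)
  have h2 : (y / x) ^ 2 - 1 = (y + x) * (y - x) / x ^ 2 := by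
    field_simp
    ring
  rw [ff, h2]
  by_cases h3 : y - x = 0
  · simp [h3]
  · field_simp

/-- The residue at `y = -x` of `y ↦ f(x / y)`. -/
theorem tendsto_mul_ff_div' (ω : ℂ) (hω : ω ≠ 0) {x : ℂ} (hx : x ≠ 0) :
    Tendsto (fun y : ℂ => (y + x) * ff ω (x / y)) (nhdsWithin (-x) {-x}ᶜ)
      (nhds (-(x * ((ω - ω⁻¹) / 2)))) := by
  have hc : ContinuousAt (fun y : ℂ => y ^ 2 * (x / y + ω) * (x / y - ω⁻¹) / (x - y)) (-x) := by
    have hx' : -x ≠ 0 := neg_ne_zero.mpr hx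
    refine ContinuousAt.div (by fun_prop (disch := assumption)) (by fun_prop) ?_
    intro h
    exact hx (by linear_combination (1 / 2 : ℂ) * h)
  have hval : (-x) ^ 2 * (x / -x + ω) * (x / -x - ω⁻¹) / (x - -x) = -(x * ((ω - ω⁻¹) / 2)) := by
    have h2 : x - -x = 2 * x := by ring
    rw [h2, div_neg]
    field_simp
    ring
  rw [← hval]
  refine (hc.tendsto.mono_left nhdsWithin_le_nhds).congr' ?_
  have hne : ∀ᶠ y in nhdsWithin (-x) {-x}ᶜ, y ≠ 0 :=
    nhdsWithin_le_nhds (isOpen_ne.mem_nhds (neg_ne_zero.mpr hx))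
  filter_upwards [self_mem_nhdsWithin, hne] with y hy hy0
  have h1 : y + x ≠ 0 := fun h => hy (eq_neg_of_add_eq_zero_left h)
  have h2 : (x / y) ^ 2 - 1 = (y + x) * (x - y) / y ^ 2 := by
    field_simp
    ring
  rw [ff, h2]
  by_cases h3 : x - y = 0
  · simp [h3]
  · field_simp

/-- The product of `f(x_i / x_j)` over `i ∈ I`, `j ∈ K`. -/
noncomputable def crossProd (ω : ℂ) {n : ℕ} (X : Fin n → ℂ) (I K : Finset (Fin n)) : ℂ :=
  ∏ i ∈ I, ∏ j ∈ K, ff ω (X i / X j)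

section crossProd

variable (ω : ℂ) {n : ℕ} (X : Fin n → ℂ) (x : ℂ) (I K : Finset (Fin n))

theorem crossProd_lift_liftLast :
    crossProd ω (Fin.snoc X x : Fin (n + 1) → ℂ) (liftSet I) (liftSetLast K) =
      (∏ i ∈ I, ff ω (X i / x)) * crossProd ω X I K := by
  simp [crossProd, prod_liftSet, prod_liftSetLast, prod_mul_distrib]

theorem crossProd_liftLast_lift :
    crossProd ω (Fin.snoc X x : Fin (n + 1) → ℂ) (liftSetLast I) (liftSet K) =
      (∏ j ∈ K, ff ω (x / X j)) * crossProd ω X I K := by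
  simp [crossProd, prod_liftSet, prod_liftSetLast]

end crossProd

/-- `J` with one variable split off. -/
theorem J_snoc (ω : ℂ) (k : ℕ → ℕ) (s : ℕ) (a : ℂ) {n : ℕ} (X : Fin n → ℂ) (y : ℂ) :
    J ω k s a (Fin.snoc X y : Fin (n + 1) → ℂ) = ∑ I : Finset (Fin n),
      (phase a (n + 1) I.card *
          (∏ m ∈ Icc 1 s, (pS m X I - (-1) ^ m * (y ^ m + pS m X Iᶜ)) ^ k m) *
          ((∏ i ∈ I, ff ω (X i / y)) * crossProd ω X I Iᶜ) +
        phase a (n + 1) (I.card + 1) *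
          (∏ m ∈ Icc 1 s, (y ^ m + pS m X I - (-1) ^ m * pS m X Iᶜ) ^ k m) *
          ((∏ j ∈ Iᶜ, ff ω (y / X j)) * crossProd ω X I Iᶜ)) := by
  rw [J, sum_finset_fin_succ]
  simp only [← crossProd.eq_1, compl_liftSet, compl_liftSetLast, card_liftSet, card_liftSetLast,
    crossProd_lift_liftLast, crossProd_liftLast_lift, Ph, pS_liftSet, pS_liftSetLast, zpow_natCast]

theorem phase_add_two (a : ℂ) (n c : ℕ) : phase a (n + 2) (c + 1) = phase a n c := by
  unfold phase
  congr 1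
  push_cast
  ring

theorem tendsto_mul_of_continuousAt {x : ℂ} {g : ℂ → ℂ} (hg : ContinuousAt g (-x)) :
    Tendsto (fun y : ℂ => (y + x) * g y) (nhdsWithin (-x) {-x}ᶜ) (nhds 0) := by
  have h : ContinuousAt (fun y : ℂ => (y + x) * g y) (-x) := by fun_prop
  simpa using h.tendsto.mono_left nhdsWithin_le_nhds

/-- the residue of `J^h_{N,a}` at the kinematic pole `x' = −x`:
`lim_{x'→−x} (x' + x) · J^h_{N,a}(x_1,…,x_{N−2}, x, x')
  = i·x·sin πp · (∏_i f(x_i/x) − ∏_i f(x/x_i)) · J^h_{N−2,a}(x_1,…,x_{N−2})`,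
with `sin πp = (ω − ω⁻¹)/(2i)`. -/
theorem stmt5 (ω : ℂ) (hω : ω ≠ 0 ∧ ω ≠ 1 ∧ ω ≠ -1)
    (k : ℕ → ℕ) (s : ℕ) (a : ℂ) (M : ℕ) (X : Fin M → ℂ) (x : ℂ)
    (hadm : Admissible (Fin.snoc X x)) :
    Filter.Tendsto (fun x' : ℂ => (x' + x) * J ω k s a (Fin.snoc (Fin.snoc X x) x'))
      (nhdsWithin (-x) {-x}ᶜ)
      (nhds (Complex.I * x * ((ω - ω⁻¹) / (2 * Complex.I)) *
        ((∏ i : Fin M, ff ω (X i / x)) - ∏ i : Fin M, ff ω (x / X i)) *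
        J ω k s a X)) := by
  obtain ⟨h0, hne⟩ := hadm
  have hx : x ≠ 0 := by simpa using h0 (Fin.last M)
  have hX : ∀ i, X i ≠ 0 := fun i => by simpa using h0 i.castSucc
  have hXx : ∀ i, X i ≠ x ∧ X i ≠ -x := fun i => by
    simpa using hne i.castSucc (Fin.last M) (Fin.castSucc_lt_last i).ne
  have hx' : -x ≠ 0 := neg_ne_zero.mpr hx
  have hcl : ∀ i, ContinuousAt (fun y => ff ω (X i / y)) (-x) := fun i =>
    ContinuousAt.comp (f := fun y : ℂ => X i / y) (g := ff ω)
      (continuousAt_ff_s5 ω (div_sq_ne_one hx' (hXx i).2 (by simpa using (hXx i).1)))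
      (by fun_prop (disch := assumption))
  have hcr : ∀ i, ContinuousAt (fun y => ff ω (y / X i)) (-x) := fun i =>
    ContinuousAt.comp (f := fun y : ℂ => y / X i) (g := ff ω)
      (continuousAt_ff_s5 ω (div_sq_ne_one (hX i) (hXx i).2.symm
        (fun h => (hXx i).1 (neg_injective h).symm)))
      (by fun_prop)
  have hclP : ∀ S : Finset (Fin M), ContinuousAt (fun y => ∏ i ∈ S, ff ω (X i / y)) (-x) :=
    fun S => tendsto_finsetProd S fun i _ => hcl i
  have hcrP : ∀ S : Finset (Fin M), ContinuousAt (fun y => ∏ i ∈ S, ff ω (y / X i)) (-x) :=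
    fun S => tendsto_finsetProd S fun i _ => hcr i
  have hres := tendsto_mul_ff_div ω hω.1 hx
  have hres' := tendsto_mul_ff_div' ω hω.1 hx
  simp only [J_snoc, sum_finset_fin_succ (n := M), compl_liftSet, compl_liftSetLast,
    card_liftSet, card_liftSetLast, crossProd_lift_liftLast, crossProd_liftLast_lift,
    pS_liftSet, pS_liftSetLast, prod_liftSet, prod_liftSetLast, Fin.snoc_castSucc, Fin.snoc_last,
    zpow_natCast, mul_sum]
  rw [J, mul_sum]
  refine tendsto_finsetSum _ fun I _ => ?_
  have hplus : ContinuousAt (fun y : ℂ => phase a (M + 1 + 1) I.card *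
      (∏ m ∈ Icc 1 s, (pS m X I - (-1) ^ m * (y ^ m + (x ^ m + pS m X Iᶜ))) ^ k m) *
      ((∏ i ∈ I, ff ω (X i / y)) * ((∏ i ∈ I, ff ω (X i / x)) * crossProd ω X I Iᶜ))) (-x) :=
    (continuousAt_const.mul (by fun_prop)).mul ((hclP I).mul continuousAt_const)
  have hminus : ContinuousAt (fun y : ℂ => phase a (M + 1 + 1) (I.card + 1 + 1) *
      (∏ m ∈ Icc 1 s, (y ^ m + (x ^ m + pS m X I) - (-1) ^ m * pS m X Iᶜ) ^ k m) *
      ((∏ j ∈ Iᶜ, ff ω (y / X j)) * ((∏ j ∈ Iᶜ, ff ω (x / X j)) * crossProd ω X I Iᶜ))) (-x) :=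
    (continuousAt_const.mul (by fun_prop)).mul ((hcrP Iᶜ).mul continuousAt_const)
  have hleft : ContinuousAt (fun y : ℂ => phase a (M + 1 + 1) (I.card + 1) *
      (∏ m ∈ Icc 1 s, (y ^ m + pS m X I - (-1) ^ m * (x ^ m + pS m X Iᶜ)) ^ k m) *
      ((∏ j ∈ Iᶜ, ff ω (y / X j)) * ((∏ i ∈ I, ff ω (X i / x)) * crossProd ω X I Iᶜ))) (-x) :=
    (continuousAt_const.mul (by fun_prop)).mul ((hcrP Iᶜ).mul continuousAt_const)
  have hright : ContinuousAt (fun y : ℂ => phase a (M + 1 + 1) (I.card + 1) *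
      (∏ m ∈ Icc 1 s, (x ^ m + pS m X I - (-1) ^ m * (y ^ m + pS m X Iᶜ)) ^ k m) *
      ((∏ i ∈ I, ff ω (X i / y)) * ((∏ j ∈ Iᶜ, ff ω (x / X j)) * crossProd ω X I Iᶜ))) (-x) :=
    (continuousAt_const.mul (by fun_prop)).mul ((hclP I).mul continuousAt_const)
  have hlim := ((tendsto_mul_of_continuousAt hplus).add
    (hres.mul (hleft.tendsto.mono_left nhdsWithin_le_nhds))).add
    ((hres'.mul (hright.tendsto.mono_left nhdsWithin_le_nhds)).add
      (tendsto_mul_of_continuousAt hminus))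
  have hPleft : ∏ m ∈ Icc 1 s, ((-x) ^ m + pS m X I - (-1) ^ m * (x ^ m + pS m X Iᶜ)) ^ k m =
      Ph k s X I Iᶜ :=
    prod_congr rfl fun m _ => by
      rw [neg_pow]
      ring
  have hPright : ∏ m ∈ Icc 1 s, (x ^ m + pS m X I - (-1) ^ m * ((-x) ^ m + pS m X Iᶜ)) ^ k m =
      Ph k s X I Iᶜ :=
    prod_congr rfl fun m _ => by
      have h : (-1 : ℂ) ^ m * (-x) ^ m = x ^ m := by rw [← mul_pow, neg_one_mul, neg_neg]
      rw [mul_add, h]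
      ring
  have hFleft : ∏ j ∈ Iᶜ, ff ω (-x / X j) = ∏ j ∈ Iᶜ, ff ω (X j / x) :=
    prod_congr rfl fun j _ => ff_neg_div hω.1 hx (hX j)
  have hFright : ∏ i ∈ I, ff ω (X i / -x) = ∏ i ∈ I, ff ω (x / X i) :=
    prod_congr rfl fun i _ => ff_div_neg hω.1 (hX i) hx
  simp only [hPleft, hPright, hFleft, hFright, phase_add_two] at hlim
  have hI : Complex.I * x * ((ω - ω⁻¹) / (2 * Complex.I)) = x * ((ω - ω⁻¹) / 2) := by
    field_simp [Complex.I_ne_zero]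
  rw [hI, ← prod_mul_prod_compl I fun i => ff ω (X i / x),
    ← prod_mul_prod_compl I fun i => ff ω (x / X i), ← crossProd.eq_1]
  convert hlim using 1
  · ext y
    simp only [phase_add_two]
    ring
  · congr 1
    ring
end

section
/- The exponential-field J functions satisfy the explicit recurrence (the Koubek–Mussardo recursion in explicit form): for every a ∈ ℂ, every N ≥ 2, and every admissible tuple (x_1,…,x_{N−1}, x), J_{N,a}(x_1,…,x_{N−1}, x) = 2 cos πa · J_{N−1,a}(x_1,…,x_{N−1}) + Σ_{i=1}^{N−1} (x_i/(x + x_i)) · R_{N,a,i}(x_1,…,x_{N−1}), where R_{N,a,i}(X) = −i·sin πp · ( ∏_{j≠i} f(x_i/x_j) − ∏_{j≠i} f(x_j/x_i) ) · J_{N−2,a}(x_1,…,x̂_i,…,x_{N−1}) and cos πa = (e^{iπa} + e^{−iπa})/2; together with J_{0,a} = 1 and J_{1,a}(x) = 2 cos πa this determines all J_{N,a} uniquely. -/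
open Finset Filter Complex

/-- The weight of the decomposition `(I, K)`, with a phase `u` for each index in `I` and
`v` for each index in `K`. -/
noncomputable def splitWeight {ι : Type*} (ω u v : ℂ) (X : ι → ℂ) (I K : Finset ι) : ℂ :=
  u ^ I.card * v ^ K.card * ∏ i ∈ I, ∏ j ∈ K, ff ω (X i / X j)

/-- The sum of `splitWeight` over all decompositions of the index set `S`. -/
noncomputable def splitSum {ι : Type*} [DecidableEq ι] (ω u v : ℂ) (X : ι → ℂ)
    (S : Finset ι) : ℂ :=
  ∑ I ∈ S.powerset, splitWeight ω u v X I (S \ I)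

lemma ff_div_eq {ω x y : ℂ} (hω : ω ≠ 0) (hy : y ≠ 0) (h1 : x ≠ y) (h2 : x ≠ -y) :
    ff ω (x / y) = 1 + (ω - ω⁻¹) / 2 * (y / (x - y) + y / (x + y)) := by
  have h1' : x - y ≠ 0 := sub_ne_zero.mpr h1
  have h2' : x + y ≠ 0 := fun h => h2 (eq_neg_of_add_eq_zero_left h)
  have h3 : (x / y) ^ 2 - 1 ≠ 0 := by
    have : (x / y) ^ 2 - 1 = (x - y) * (x + y) / y ^ 2 := by field_simp; ring
    rw [this]
    exact div_ne_zero (mul_ne_zero h1' h2') (pow_ne_zero 2 hy)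
  rw [ff, div_eq_iff h3]
  field_simp
  ring

lemma ff_inv_eq_ff_neg {ω x y : ℂ} (hω : ω ≠ 0) (hx : x ≠ 0) (hy : y ≠ 0)
    (h1 : x ≠ y) (h2 : x ≠ -y) : ff ω (y / x) = ff ω (-x / y) := by
  have h1' : x - y ≠ 0 := sub_ne_zero.mpr h1
  have h2' : x + y ≠ 0 := fun h => h2 (eq_neg_of_add_eq_zero_left h)
  rw [ff_div_eq hω hx h1.symm (fun h => h2 (by rw [h, neg_neg])),
    ff_div_eq hω hy (fun h => h2 (by rw [← h, neg_neg])) (fun h => h1 (neg_injective h))]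
  have e1 : y - x = -(x - y) := by ring
  have e2 : y + x = x + y := by ring
  have e3 : -x - y = -(x + y) := by ring
  have e4 : -x + y = -(x - y) := by ring
  rw [e1, e2, e3, e4]
  field_simp
  ring

/-- The contribution of the poles at `±y` to the partial fraction expansion of
`∏ j ∈ K, ff ω (x / X j)`. -/
noncomputable def polePart {ι : Type*} (ω : ℂ) (X : ι → ℂ) (K : Finset ι) (x y : ℂ) : ℂ :=
  (ω - ω⁻¹) / 2 * (y / (x - y) * ∏ j ∈ K, ff ω (y / X j)
    + y / (x + y) * ∏ j ∈ K, ff ω (-y / X j))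

/-- Partial fraction expansion of `∏ j ∈ K, ff ω (x / X j)`. -/
lemma prod_ff_eq_one_add_sum_polePart {ι : Type*} [DecidableEq ι] {ω : ℂ} (hω : ω ≠ 0)
    {X : ι → ℂ} (K : Finset ι) (h0 : ∀ i ∈ K, X i ≠ 0)
    (hK : ∀ i ∈ K, ∀ j ∈ K, i ≠ j → X i ≠ X j ∧ X i ≠ -X j) (x : ℂ)
    (hx : ∀ i ∈ K, x ≠ X i ∧ x ≠ -X i) :
    ∏ j ∈ K, ff ω (x / X j) = 1 + ∑ i ∈ K, polePart ω X (K.erase i) x (X i) := by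
  induction K using Finset.induction_on generalizing x with
  | empty => simp
  | insert k K hk ih =>
    have h0' : ∀ i ∈ K, X i ≠ 0 := fun i hi => h0 i (mem_insert_of_mem hi)
    have hK' : ∀ i ∈ K, ∀ j ∈ K, i ≠ j → X i ≠ X j ∧ X i ≠ -X j := fun i hi j hj =>
      hK i (mem_insert_of_mem hi) j (mem_insert_of_mem hj)
    have hk0 : X k ≠ 0 := h0 k (mem_insert_self k K)
    have hkK : ∀ i ∈ K, X k ≠ X i ∧ X k ≠ -X i := fun i hi =>
      hK k (mem_insert_self k K) i (mem_insert_of_mem hi) (fun h => hk (h ▸ hi))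
    have hkK' : ∀ i ∈ K, -X k ≠ X i ∧ -X k ≠ -X i := fun i hi =>
      ⟨fun h => (hkK i hi).2 (by rw [← h, neg_neg]), fun h => (hkK i hi).1 (neg_injective h)⟩
    obtain ⟨hxk, hxk'⟩ := hx k (mem_insert_self k K)
    have hxK : ∀ i ∈ K, x ≠ X i ∧ x ≠ -X i := fun i hi => hx i (mem_insert_of_mem hi)
    rw [prod_insert hk, sum_insert hk, erase_insert hk, ih h0' hK' x hxK]
    rw [polePart, ih h0' hK' _ hkK, ih h0' hK' _ hkK', ff_div_eq hω hk0 hxk hxk']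
    have key : ∀ i ∈ K, polePart ω X ((insert k K).erase i) x (X i)
        = (1 + (ω - ω⁻¹) / 2 * (X k / (x - X k) + X k / (x + X k)))
            * polePart ω X (K.erase i) x (X i)
          - (ω - ω⁻¹) / 2 * (X k / (x - X k) * polePart ω X (K.erase i) (X k) (X i)
            + X k / (x + X k) * polePart ω X (K.erase i) (-X k) (X i)) := by
      intro i hi
      have hki : k ≠ i := fun h => hk (h ▸ hi)
      rw [erase_insert_of_ne hki]
      have hke : k ∉ K.erase i := fun h => hk (mem_of_mem_erase h)
      unfold polePart
      rw [prod_insert hke, prod_insert hke]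
      obtain ⟨a1, a2⟩ := hkK i hi
      obtain ⟨b1, b2⟩ := hxK i hi
      rw [ff_div_eq hω hk0 a1.symm (fun h => a2 (by rw [h, neg_neg])),
        ff_div_eq hω hk0 (fun h => a2 h.symm) (fun h => a1 (neg_injective h).symm)]
      generalize ∏ j ∈ K.erase i, ff ω (X i / X j) = P
      generalize ∏ j ∈ K.erase i, ff ω (-X i / X j) = Q
      generalize (ω - ω⁻¹) / 2 = c
      generalize X i = y at *
      generalize X k = z at *
      have c1 : x - z ≠ 0 := sub_ne_zero.mpr hxk
      have c2 : x + z ≠ 0 := fun h => hxk' (eq_neg_of_add_eq_zero_left h)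
      have c3 : x - y ≠ 0 := sub_ne_zero.mpr b1
      have c4 : x + y ≠ 0 := fun h => b2 (eq_neg_of_add_eq_zero_left h)
      have c5 : z - y ≠ 0 := sub_ne_zero.mpr a1
      have c6 : z + y ≠ 0 := fun h => a2 (eq_neg_of_add_eq_zero_left h)
      have e1 : y - z = -(z - y) := by ring
      have e2 : y + z = z + y := by ring
      have e3 : -y - z = -(z + y) := by ring
      have e4 : -y + z = z - y := by ring
      have e5 : -z - y = -(z + y) := by ring
      have e6 : -z + y = -(z - y) := by ring
      rw [e1, e2, e3, e4, e5, e6]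
      field_simp
      ring
    rw [sum_congr rfl key]
    simp only [sum_sub_distrib, sum_add_distrib, ← mul_sum]
    ring

section SplitSum

variable {ι : Type*} [DecidableEq ι] (ω u v : ℂ) (X : ι → ℂ)

lemma splitWeight_insert_left {I : Finset ι} (K : Finset ι) {k : ι} (hk : k ∉ I) :
    splitWeight ω u v X (insert k I) K
      = splitWeight ω u v X I K * (u * ∏ j ∈ K, ff ω (X k / X j)) := by
  rw [splitWeight, splitWeight, card_insert_of_notMem hk, prod_insert hk]
  ring

lemma splitWeight_insert_right (I : Finset ι) {K : Finset ι} {k : ι} (hk : k ∉ K) :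
    splitWeight ω u v X I (insert k K)
      = splitWeight ω u v X I K * (v * ∏ i ∈ I, ff ω (X i / X k)) := by
  rw [splitWeight, splitWeight, card_insert_of_notMem hk,
    prod_congr rfl fun i _ => prod_insert hk, prod_mul_distrib]
  ring

/-- Summing over decompositions of `insert k S` by first decomposing `S` and then placing `k`. -/
lemma sum_splitWeight_insert {S : Finset ι} {k : ι} (hk : k ∉ S) (G : Finset ι → ℂ) :
    ∑ I ∈ (insert k S).powerset, splitWeight ω u v X I (insert k S \ I) * G I
      = ∑ I ∈ S.powerset, splitWeight ω u v X I (S \ I) *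
          (v * (∏ i ∈ I, ff ω (X i / X k)) * G I
            + u * (∏ j ∈ S \ I, ff ω (X k / X j)) * G (insert k I)) := by
  rw [sum_powerset_insert hk, ← sum_add_distrib]
  refine sum_congr rfl fun I hI => ?_
  have hkI : k ∉ I := fun h => hk (mem_powerset.mp hI h)
  rw [insert_sdiff_of_notMem _ hkI, insert_sdiff_insert, sdiff_insert_of_notMem hk,
    splitWeight_insert_left _ _ _ _ _ hkI,
    splitWeight_insert_right _ _ _ _ _ (fun h => hk (mem_sdiff.mp h).1)]
  ring

lemma splitSum_insert {S : Finset ι} {k : ι} (hk : k ∉ S) :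
    splitSum ω u v X (insert k S)
      = ∑ I ∈ S.powerset, splitWeight ω u v X I (S \ I) *
          (v * (∏ i ∈ I, ff ω (X i / X k)) + u * ∏ j ∈ S \ I, ff ω (X k / X j)) := by
  simpa [splitSum] using sum_splitWeight_insert ω u v X hk fun _ => 1

lemma splitSum_map {κ : Type*} [DecidableEq κ] (e : κ ↪ ι) (S : Finset κ) :
    splitSum ω u v X (S.map e) = splitSum ω u v (X ∘ e) S := by
  refine (sum_bij (fun I _ => I.map e) (fun I hI => ?_) (fun I _ K _ h => map_injective e h)
    (fun I hI => ?_) fun I _ => ?_).symm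
  · exact mem_powerset.mpr (map_subset_map.mpr (mem_powerset.mp hI))
  · obtain ⟨K, hK, rfl⟩ := subset_map_iff.mp (mem_powerset.mp hI)
    exact ⟨K, mem_powerset.mpr hK, rfl⟩
  · rw [← Finset.map_sdiff]
    simp [splitWeight]

variable {ω u v X}

/-- The contribution of the poles at `±X i` to `splitSum` as a function of an extra entry `x`. -/
lemma sum_splitWeight_mul_polePart (hω : ω ≠ 0) (huv : u * v = 1) {S : Finset ι} {i : ι}
    (hi : i ∉ S) (hne : ∀ j ∈ S, X i ≠ X j ∧ X i ≠ -X j) (h0 : ∀ j ∈ S, X j ≠ 0) (hi0 : X i ≠ 0)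
    (x : ℂ) :
    ∑ I ∈ (insert i S).powerset, splitWeight ω u v X I (insert i S \ I) *
        (if i ∈ I then v * polePart ω X (I.erase i) (-x) (X i)
          else u * polePart ω X ((insert i S \ I).erase i) x (X i))
      = X i / (x + X i) * (-((ω - ω⁻¹) / 2) *
          ((∏ j ∈ S, ff ω (X i / X j)) - ∏ j ∈ S, ff ω (X j / X i)) *
          splitSum ω u v X S) := by
  rw [sum_splitWeight_insert _ _ _ _ hi, splitSum, mul_sum, mul_sum]
  refine sum_congr rfl fun I hI => ?_
  have hIS : I ⊆ S := mem_powerset.mp hI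
  have hiI : i ∉ I := fun h => hi (hIS h)
  have hneg : ∀ T ⊆ S, ∏ j ∈ T, ff ω (-X i / X j) = ∏ j ∈ T, ff ω (X j / X i) :=
    fun T hT => prod_congr rfl fun j hj =>
      (ff_inv_eq_ff_neg hω hi0 (h0 j (hT hj)) (hne j (hT hj)).1 (hne j (hT hj)).2).symm
  rw [if_neg hiI, if_pos (mem_insert_self i I), erase_insert hiI,
    insert_sdiff_of_notMem _ hiI, erase_insert (fun h => hi (mem_sdiff.mp h).1),
    ← prod_sdiff hIS, ← prod_sdiff hIS, polePart, polePart, hneg I hIS, hneg _ sdiff_subset]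
  have e1 : -x - X i = -(x + X i) := by ring
  have e2 : -x + X i = -(x - X i) := by ring
  rw [e1, e2, div_neg, div_neg]
  linear_combination (splitWeight ω u v X I (S \ I) * (X i / (x + X i)) * ((ω - ω⁻¹) / 2) *
    ((∏ j ∈ S \ I, ff ω (X j / X i)) * (∏ j ∈ I, ff ω (X j / X i)) -
     (∏ j ∈ S \ I, ff ω (X i / X j)) * (∏ j ∈ I, ff ω (X i / X j)))) * huv

/-- The recursion for `splitSum` when the index `k` is added to `S`. -/
theorem splitSum_insert_eq (hω : ω ≠ 0) (huv : u * v = 1) {S : Finset ι} {k : ι} (hk : k ∉ S)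
    (h0 : ∀ i, X i ≠ 0) (hne : ∀ i j, i ≠ j → X i ≠ X j ∧ X i ≠ -X j) :
    splitSum ω u v X (insert k S) = (u + v) * splitSum ω u v X S +
      ∑ i ∈ S, X i / (X k + X i) * (-((ω - ω⁻¹) / 2) *
          ((∏ j ∈ S.erase i, ff ω (X i / X j)) - ∏ j ∈ S.erase i, ff ω (X j / X i)) *
          splitSum ω u v X (S.erase i)) := by
  have hkS : ∀ i ∈ S, k ≠ i := fun i hi h => hk (h ▸ hi)
  have expand : ∀ I ∈ S.powerset, splitWeight ω u v X I (S \ I) *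
      (v * (∏ i ∈ I, ff ω (X i / X k)) + u * ∏ j ∈ S \ I, ff ω (X k / X j))
      = (u + v) * splitWeight ω u v X I (S \ I) +
        ∑ i ∈ S, splitWeight ω u v X I (S \ I) *
          (if i ∈ I then v * polePart ω X (I.erase i) (-X k) (X i)
            else u * polePart ω X ((S \ I).erase i) (X k) (X i)) := by
    intro I hI
    have hIS : I ⊆ S := mem_powerset.mp hI
    rw [prod_congr rfl fun i hi => ff_inv_eq_ff_neg hω (h0 k) (h0 i)
        (hne k i (hkS i (hIS hi))).1 (hne k i (hkS i (hIS hi))).2,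
      prod_ff_eq_one_add_sum_polePart hω I (fun i _ => h0 i) (fun i _ j _ => hne i j) _
        (fun i hi => ⟨fun h => (hne k i (hkS i (hIS hi))).2 (by rw [← h, neg_neg]),
          fun h => (hne k i (hkS i (hIS hi))).1 (neg_injective h)⟩),
      prod_ff_eq_one_add_sum_polePart hω (S \ I) (fun i _ => h0 i) (fun i _ j _ => hne i j) _
        (fun i hi => hne k i (hkS i (mem_sdiff.mp hi).1)),
      ← mul_sum, ← sum_sdiff hIS,
      sum_congr (rfl : I = I) fun i hi => if_pos hi,
      sum_congr (rfl : S \ I = S \ I) fun i hi => if_neg (mem_sdiff.mp hi).2,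
      ← mul_sum, ← mul_sum]
    ring
  rw [splitSum_insert _ _ _ _ hk, sum_congr rfl expand, sum_add_distrib, ← mul_sum, sum_comm]
  congr 1
  refine sum_congr rfl fun i hi => ?_
  have := sum_splitWeight_mul_polePart (u := u) (v := v) hω huv (notMem_erase i S)
    (fun j hj => hne i j (ne_of_mem_erase hj).symm) (fun j _ => h0 j) (h0 i) (X k)
  rwa [insert_erase hi] at this

end SplitSum

lemma Jexp_eq_splitSum (ω a : ℂ) {N : ℕ} (X : Fin N → ℂ) :
    Jexp ω a X = splitSum ω (Complex.exp (Complex.I * (Real.pi : ℂ) * a))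
      (Complex.exp (-(Complex.I * (Real.pi : ℂ) * a))) X univ := by
  rw [Jexp, splitSum, powerset_univ]
  refine sum_congr rfl fun I _ => ?_
  rw [splitWeight, ← compl_eq_univ_sdiff, phase, ← Complex.exp_nat_mul, ← Complex.exp_nat_mul,
    ← Complex.exp_add]
  congr 2
  have h : (I.card : ℂ) + (Iᶜ.card : ℂ) = N := by
    rw [← Nat.cast_add, card_add_card_compl, Fintype.card_fin]
  rw [← h]
  ring

/-- the Koubek–Mussardo recursion in explicit form: for admissible
`(x_1,…,x_{N−1}, x)` (here `N − 1 = M + 1 ≥ 1`),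
`J_{N,a}(x_1,…,x_{N−1},x) = 2cos πa · J_{N−1,a}(x_1,…,x_{N−1})
   + Σ_i (x_i/(x+x_i)) · R_{N,a,i}(x_1,…,x_{N−1})`, where
`R_{N,a,i}(X) = −i sin πp · (∏_{j≠i} f(x_i/x_j) − ∏_{j≠i} f(x_j/x_i)) · J_{N−2,a}(…,x̂_i,…)`,
`2cos πa = e^{iπa} + e^{−iπa}`, `sin πp = (ω−ω⁻¹)/(2i)`.  Together with `J_{0,a} = 1` and
`J_{1,a}(x) = 2cos πa` (which hold by definition) this determines all `J_{N,a}` uniquely. -/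
theorem stmt6 (ω : ℂ) (hω : ω ≠ 0 ∧ ω ≠ 1 ∧ ω ≠ -1) (a : ℂ)
    (M : ℕ) (X : Fin (M + 1) → ℂ) (x : ℂ) (hadm : Admissible (Fin.snoc X x)) :
    Jexp ω a (Fin.snoc X x) =
      (Complex.exp (Complex.I * (Real.pi : ℂ) * a)
        + Complex.exp (-(Complex.I * (Real.pi : ℂ) * a))) * Jexp ω a X +
      ∑ i : Fin (M + 1), (X i / (x + X i)) *
        (-Complex.I * ((ω - ω⁻¹) / (2 * Complex.I)) *
          ((∏ j ∈ ({i}ᶜ : Finset (Fin (M + 1))), ff ω (X i / X j)) -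
            ∏ j ∈ ({i}ᶜ : Finset (Fin (M + 1))), ff ω (X j / X i)) *
          Jexp ω a (X ∘ i.succAbove)) := by
  have huv : Complex.exp (Complex.I * (Real.pi : ℂ) * a)
      * Complex.exp (-(Complex.I * (Real.pi : ℂ) * a)) = 1 := by
    rw [← Complex.exp_add, add_neg_cancel, Complex.exp_zero]
  have hcoef : -Complex.I * ((ω - ω⁻¹) / (2 * Complex.I)) = -((ω - ω⁻¹) / 2) := by
    field_simp
  have hX : X = (Fin.snoc X x : Fin (M + 2) → ℂ) ∘ Fin.castSuccEmb := by
    ext i; simp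
  have huniv : (univ : Finset (Fin (M + 2))) =
      insert (Fin.last (M + 1)) (univ.map Fin.castSuccEmb) := by
    rw [Fin.univ_castSuccEmb, cons_eq_insert]
  have hlast : Fin.last (M + 1) ∉ (univ : Finset (Fin (M + 1))).map Fin.castSuccEmb := by
    simp
  have hsucc : ∀ i : Fin (M + 1), (univ : Finset (Fin (M + 1))).erase i
      = univ.map i.succAboveEmb := by
    intro i
    ext j
    simp [Fin.exists_succAbove_eq_iff]
  rw [Jexp_eq_splitSum, huniv, splitSum_insert_eq hω.1 huv hlast hadm.1 hadm.2,
    splitSum_map, ← hX, ← Jexp_eq_splitSum, sum_map]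
  congr 1
  refine sum_congr rfl fun i _ => ?_
  rw [← map_erase, splitSum_map, prod_map, prod_map, ← hX, hsucc i, splitSum_map, ← hsucc i,
    Jexp_eq_splitSum, hcoef, compl_eq_univ_sdiff, sdiff_singleton_eq_erase]
  simp
end

section
/- The sum of kinematic residues of the exponential-field J functions vanishes: for every a ∈ ℂ, every M ≥ 1, and every admissible tuple (x_1,…,x_M), Σ_{i=1}^{M} ( ∏_{j≠i} f(x_i/x_j) − ∏_{j≠i} f(x_j/x_i) ) · J_{M−1,a}(x_1,…,x̂_i,…,x_M) = 0. -/
open Finset Filter Complex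

theorem ff_div {ω x : ℂ} (hx : x ≠ 0) (z : ℂ) :
    ff ω (z / x) = (z + ω * x) * (z - ω⁻¹ * x) / ((z - x) * (z + x)) := by
  have hnum : (z / x + ω) * (z / x - ω⁻¹) = (z + ω * x) * (z - ω⁻¹ * x) / x ^ 2 := by
    field_simp
  have hden : (z / x) ^ 2 - 1 = (z - x) * (z + x) / x ^ 2 := by
    field_simp
    ring
  rw [ff, hnum, hden, div_div_div_cancel_right₀ (pow_ne_zero 2 hx)]

open Polynomial in
/-- Partial fractions: comparing the values at `0` and `∞` of `∏ l ∈ K, ff ω (z / x l)`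
with its residues at `z = ± x j`. -/
theorem sum_prod_ff_eq_sum_prod_ff_neg {ι : Type*} [DecidableEq ι] {ω : ℂ}
    (hω : ω ≠ 0 ∧ ω ≠ 1 ∧ ω ≠ -1) (x : ι → ℂ) (hx : ∀ i, x i ≠ 0)
    (hxx : ∀ i j, i ≠ j → x i ≠ x j ∧ x i ≠ -x j) (K : Finset ι) :
    ∑ j ∈ K, ∏ l ∈ K.erase j, ff ω (x j / x l) =
      ∑ j ∈ K, ∏ l ∈ K.erase j, ff ω (-x j / x l) := by
  obtain ⟨h0, h1, h2⟩ := hω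
  set v : Option (ι × Bool) → ℂ := fun o =>
    o.elim 0 fun p => if p.2 then x p.1 else -x p.1 with hv
  set T : Finset (ι × Bool) := K ×ˢ univ with hT
  set P : ℂ[X] := ∏ l ∈ K, ((X + C (ω * x l)) * (X - C (ω⁻¹ * x l))) with hP
  have heval (z : ℂ) : P.eval z = ∏ l ∈ K, ((z + ω * x l) * (z - ω⁻¹ * x l)) := by
    simp [hP, eval_prod]
  have hfac (l : ι) : ((X + C (ω * x l)) * (X - C (ω⁻¹ * x l))).Monic :=
    (monic_X_add_C _).mul (monic_X_sub_C _)
  have hmonic : P.Monic := monic_prod_of_monic _ _ fun l _ => hfac l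
  have hdeg : P.natDegree = 2 * #K := by
    rw [hP, natDegree_prod_of_monic _ _ fun l _ => hfac l]
    rw [sum_congr rfl fun l _ => (monic_X_add_C _).natDegree_mul (monic_X_sub_C _)]
    simp only [natDegree_X_add_C, natDegree_X_sub_C, sum_const, smul_eq_mul]
    ring
  have hv_ne (j : ι) (b : Bool) : v (some (j, b)) ≠ 0 := by
    have := hx j
    cases b <;> simpa [hv]
  have hinj : Function.Injective v := by
    have hself (i : ι) : x i ≠ -x i := fun h => hx i (self_eq_neg.mp h)
    have key (i j : ι) (b c : Bool)
        (h : (if b then x i else -x i) = if c then x j else -x j) : i = j ∧ b = c := by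
      have := hself i
      have := hxx i j
      cases b <;> cases c <;> grind
    rintro (_ | ⟨i, b⟩) (_ | ⟨j, c⟩) h
    · rfl
    · exact absurd h.symm (hv_ne j c)
    · exact absurd h (hv_ne i b)
    · obtain ⟨rfl, rfl⟩ := key i j b c h
      rfl
  have hcard : (#(insertNone T) : WithBot ℕ) = P.degree + 1 := by
    rw [degree_eq_natDegree hmonic.ne_zero, hdeg, card_insertNone, hT, card_product]
    simp [mul_comm]
  have hsum := Lagrange.leadingCoeff_eq_sum (s := insertNone T) hinj.injOn hcard
  have hzero : P.eval (v none) / ∏ o ∈ (insertNone T).erase none, (v none - v o) = 1 := by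
    have herase : (insertNone T).erase none = T.map Function.Embedding.some := by
      ext (_ | p) <;> simp
    rw [herase, prod_map, hT, prod_product, heval, ← prod_div_distrib]
    refine prod_eq_one fun l _ => ?_
    have := hx l
    simp [hv]
    field_simp
  have hnode (j : ι) (hj : j ∈ K) (b : Bool) :
      P.eval (v (some (j, b))) /
          ∏ o ∈ (insertNone T).erase (some (j, b)), (v (some (j, b)) - v o) =
        (v (some (j, b)) + ω * x j) * (v (some (j, b)) - ω⁻¹ * x j) /
          (2 * v (some (j, b)) ^ 2) * ∏ l ∈ K.erase j, ff ω (v (some (j, b)) / x l) := by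
    have herase : (insertNone T).erase (some (j, b)) =
        insert none (insert (some (j, !b))
          (((K.erase j) ×ˢ univ).map Function.Embedding.some)) := by
      ext (_ | ⟨l, c⟩)
      · simp
      · by_cases hl : l = j
        · subst hl
          cases b <;> cases c <;> simp [hT, hj]
        · simp [hT, hl]
    have hneg : v (some (j, !b)) = -v (some (j, b)) := by
      cases b <;> simp [hv]
    have hz : v none = 0 := rfl
    rw [herase, prod_insert (by simp), prod_insert (by simp), prod_map, prod_product, heval,
      ← mul_prod_erase K _ hj, hneg, hz]
    generalize v (some (j, b)) = z
    rw [← mul_assoc, mul_div_mul_comm, ← prod_div_distrib]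
    congr 1
    · congr 1
      ring
    · refine prod_congr rfl fun l _ => ?_
      rw [ff_div (hx l)]
      simp [hv]
  rw [hmonic.leadingCoeff, sum_insertNone, hzero, hT, sum_product,
    sum_congr rfl fun j hj => Fintype.sum_congr _ _ (hnode j hj)] at hsum
  have hcoef : (1 + ω) * (1 - ω⁻¹) / 2 ≠ 0 := by
    have h3 : 1 + ω ≠ 0 := fun h => h2 (by linear_combination h)
    have h4 : 1 - ω⁻¹ ≠ 0 := fun h => h1 (inv_eq_one.mp (by linear_combination -h))
    simp [h3, h4]
  refine mul_left_cancel₀ hcoef ?_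
  rw [← sub_eq_zero, mul_sum, mul_sum, ← sum_sub_distrib, ← add_eq_left.mp hsum.symm]
  refine sum_congr rfl fun j _ => ?_
  have := hx j
  simp only [Fintype.sum_bool, hv, Option.elim_some, if_true, Bool.false_eq_true, if_false]
  rw [sub_eq_add_neg, ← neg_mul]
  congr 2 <;> field_simp
  ring

/-- The kinematic residue sum vanishes for any weights depending only on `#I` and any
`F` satisfying the one-particle identity on every subset. -/
theorem sum_residue_eq_zero_s7 {ι R : Type*} [Fintype ι] [DecidableEq ι] [CommRing R]
    (F : ι → ι → R) (w : ℕ → R)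
    (hF : ∀ K : Finset ι, ∑ j ∈ K, ∏ l ∈ K.erase j, F j l = ∑ j ∈ K, ∏ l ∈ K.erase j, F l j) :
    ∑ i, ((∏ j ∈ ({i}ᶜ : Finset ι), F i j) - ∏ j ∈ ({i}ᶜ : Finset ι), F j i) *
      ∑ I with i ∉ I, w #I * ∏ p ∈ I, ∏ q ∈ (insert i I)ᶜ, F p q = 0 := by
  have hsplit (i : ι) (I : Finset ι) (hi : i ∉ I) (g : ι → R) :
      ∏ j ∈ ({i}ᶜ : Finset ι), g j = (∏ j ∈ I, g j) * ∏ j ∈ (insert i I)ᶜ, g j := by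
    rw [← prod_union (by grind [disjoint_left, mem_compl])]
    congr 1
    ext j
    by_cases j ∈ I <;> grind [mem_compl]
  have hterm (i : ι) (I : Finset ι) (hi : i ∉ I) :
      ((∏ j ∈ ({i}ᶜ : Finset ι), F i j) - ∏ j ∈ ({i}ᶜ : Finset ι), F j i) *
        (w #I * ∏ p ∈ I, ∏ q ∈ (insert i I)ᶜ, F p q) =
      w #I * (∏ p ∈ insert i I, ∏ q ∈ (insert i I)ᶜ, F p q) *
          ((∏ j ∈ I, F i j) - ∏ j ∈ I, F j i) +
        w #I * (∏ p ∈ I, ∏ q ∈ Iᶜ, F p q) *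
          ((∏ j ∈ Iᶜ.erase i, F i j) - ∏ j ∈ Iᶜ.erase i, F j i) := by
    have hc : Iᶜ = insert i (insert i I)ᶜ := by
      ext j
      by_cases j = i <;> grind [mem_compl]
    have hic : i ∉ (insert i I)ᶜ := by simp
    rw [hsplit i I hi, hsplit i I hi, prod_insert hi, hc, erase_insert hic]
    simp only [prod_insert hic, prod_mul_distrib]
    ring
  have hleft : ∑ i, ∑ I with i ∉ I, w #I * (∏ p ∈ insert i I, ∏ q ∈ (insert i I)ᶜ, F p q) *
      ((∏ j ∈ I, F i j) - ∏ j ∈ I, F j i) = 0 := by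
    have hreindex (i : ι) :
        ∑ I with i ∉ I, w #I * (∏ p ∈ insert i I, ∏ q ∈ (insert i I)ᶜ, F p q) *
            ((∏ j ∈ I, F i j) - ∏ j ∈ I, F j i) =
          ∑ A with i ∈ A, w (#A - 1) * (∏ p ∈ A, ∏ q ∈ Aᶜ, F p q) *
            ((∏ j ∈ A.erase i, F i j) - ∏ j ∈ A.erase i, F j i) := by
      refine sum_nbij' (insert i) (fun A => A.erase i) ?_ ?_ ?_ ?_ ?_
      · simp
      · simp
      · intro I hI
        exact erase_insert (by simpa using hI)
      · intro A hA
        exact insert_erase (by simpa using hA)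
      · intro I hI
        have hi : i ∉ I := by simpa using hI
        rw [erase_insert hi, card_insert_of_notMem hi, Nat.add_sub_cancel]
    rw [sum_congr rfl fun i _ => hreindex i,
      sum_comm' (t' := univ) (s' := fun A => A) (by simp)]
    refine sum_eq_zero fun A _ => ?_
    rw [← mul_sum, sum_sub_distrib, hF, sub_self, mul_zero]
  have hright : ∑ i, ∑ I with i ∉ I, w #I * (∏ p ∈ I, ∏ q ∈ Iᶜ, F p q) *
      ((∏ j ∈ Iᶜ.erase i, F i j) - ∏ j ∈ Iᶜ.erase i, F j i) = 0 := by
    rw [sum_comm' (t' := univ) (s' := fun I => Iᶜ) (by simp)]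
    refine sum_eq_zero fun I _ => ?_
    rw [← mul_sum, sum_sub_distrib, hF, sub_self, mul_zero]
  rw [← add_zero (0 : R)]
  nth_rw 1 [← hleft]
  rw [← hright, ← sum_add_distrib]
  refine sum_congr rfl fun i _ => ?_
  rw [mul_sum, ← sum_add_distrib]
  exact sum_congr rfl fun I hI => hterm i I (by simpa using hI)

theorem Jexp_comp_succAbove (ω a : ℂ) {M : ℕ} (X : Fin (M + 1) → ℂ) (i : Fin (M + 1)) :
    Jexp ω a (X ∘ i.succAbove) =
      ∑ I with i ∉ I, phase a M #I * ∏ p ∈ I, ∏ q ∈ (insert i I)ᶜ, ff ω (X p / X q) := by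
  have himage : (univ.filter fun I : Finset (Fin (M + 1)) => i ∉ I) =
      univ.map (mapEmbedding i.succAboveEmb).toEmbedding := by
    ext I
    simp only [mem_filter, mem_univ, true_and, Finset.mem_map, RelEmbedding.coe_toEmbedding,
      mapEmbedding_apply]
    constructor
    · intro hi
      refine ⟨univ.filter fun k => i.succAbove k ∈ I, ?_⟩
      ext j
      rcases Fin.eq_self_or_eq_succAbove i j with rfl | ⟨k, rfl⟩ <;> simp [hi]
    · rintro ⟨I, rfl⟩
      simp
  have hcompl (I : Finset (Fin M)) :
      (insert i (I.map i.succAboveEmb))ᶜ = Iᶜ.map i.succAboveEmb := by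
    ext j
    rcases Fin.eq_self_or_eq_succAbove i j with rfl | ⟨k, rfl⟩ <;> simp
  rw [himage, sum_map, Jexp]
  refine sum_congr rfl fun I _ => ?_
  simp [mapEmbedding_apply, hcompl]

theorem ff_inv {ω : ℂ} (hω : ω ≠ 0) {x : ℂ} (hx : x ≠ 0) (h : x ^ 2 ≠ 1) :
    ff ω x⁻¹ = ff ω (-x) := by
  have h₁ : x ^ 2 - 1 ≠ 0 := sub_ne_zero.mpr h
  have h₂ : 1 - x ^ 2 ≠ 0 := sub_ne_zero.mpr h.symm
  have h₃ : x⁻¹ ^ 2 - 1 = (1 - x ^ 2) / x ^ 2 := by field_simp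
  rw [ff, ff, h₃, neg_sq]
  field_simp
  ring

/-- the sum of kinematic residues of the exponential-field `J` functions
vanishes: for every admissible `(x_1,…,x_M)` (here `M = M' + 1 ≥ 1`),
`Σ_{i=1}^M (∏_{j≠i} f(x_i/x_j) − ∏_{j≠i} f(x_j/x_i)) · J_{M−1,a}(x_1,…,x̂_i,…,x_M) = 0`. -/
theorem stmt7 (ω : ℂ) (hω : ω ≠ 0 ∧ ω ≠ 1 ∧ ω ≠ -1) (a : ℂ)
    (M : ℕ) (X : Fin (M + 1) → ℂ) (hadm : Admissible X) :
    ∑ i : Fin (M + 1),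
      ((∏ j ∈ ({i}ᶜ : Finset (Fin (M + 1))), ff ω (X i / X j)) -
        ∏ j ∈ ({i}ᶜ : Finset (Fin (M + 1))), ff ω (X j / X i)) *
      Jexp ω a (X ∘ i.succAbove) = 0 := by
  obtain ⟨hX, hXX⟩ := hadm
  simp only [Jexp_comp_succAbove]
  refine sum_residue_eq_zero_s7 (fun p q => ff ω (X p / X q)) (phase a M) fun K => ?_
  rw [sum_prod_ff_eq_sum_prod_ff_neg hω X hX hXX]
  refine sum_congr rfl fun j _ => prod_congr rfl fun l hl => ?_
  have hne := hXX j l (ne_of_mem_erase hl).symm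
  rw [neg_div, ← ff_inv hω.1 (div_ne_zero (hX j) (hX l)), inv_div]
  rw [div_pow, Ne, div_eq_one_iff_eq (pow_ne_zero 2 (hX l)), sq_eq_sq_iff_eq_or_eq_neg]
  tauto
end

section
/- Relation between the kink-sector and breather-sector solutions: let σ ∈ ℂ be nonzero, set K_m = i^{−m}(σ^m − σ^{−m}) (so that if σ = e^{iπp/2} then K_m = 2 i^{1−m} sin(πpm/2)), and let h be a partition with multiplicities (k_1,…,k_s) such that K_m ≠ 0 whenever k_m > 0. Then for all finite tuples X_−, X_+ of complex numbers with union X: Q^h( ((−iσx)_{x∈X}) ∪ ((iσ^{−1}x)_{x∈X}) | ((σ^{−1}x)_{x∈X_−}) ∪ ((σx)_{x∈X_+}) ) = K_h · P^h(X_− | X_+), where K_h = ∏_{m=1}^s K_m^{k_m}. -/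
/-- The power sum `S_m(X) = Σ_{y ∈ X} y^m` of a finite tuple (list) of complex numbers. -/
noncomputable def Slist (m : ℕ) (X : List ℂ) : ℂ := (X.map (fun y => y ^ m)).sum

/-- The breather-sector polynomial
`P^h(X_-|X_+) = ∏_{m=1}^s (S_m(X_-) − (−1)^m S_m(X_+))^{k_m}`. -/
noncomputable def Plist (k : ℕ → ℕ) (s : ℕ) (Xm Xp : List ℂ) : ℂ :=
  ∏ m ∈ Finset.Icc 1 s, (Slist m Xm - (-1 : ℂ) ^ m * Slist m Xp) ^ k m

/-- The kink-sector polynomial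
`Q^h(X|Z) = ∏_{odd m ≤ s} S_m(X)^{k_m} · ∏_{2m' ≤ s} (S_{2m'}(X) + 2(−1)^{m'−1} S_{2m'}(Z))^{k_{2m'}}`. -/
noncomputable def Qlist (k : ℕ → ℕ) (s : ℕ) (X Z : List ℂ) : ℂ :=
  (∏ m ∈ (Finset.Icc 1 s).filter (fun m => Odd m), Slist m X ^ k m) *
  ∏ m' ∈ Finset.Icc 1 (s / 2),
    (Slist (2 * m') X + 2 * (-1 : ℂ) ^ (m' - 1) * Slist (2 * m') Z) ^ k (2 * m')

/-- The constant `K_m = i^{−m}(σ^m − σ^{−m})`. -/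
noncomputable def Kconst (σ : ℂ) (m : ℕ) : ℂ :=
  Complex.I ^ (-(m : ℤ)) * (σ ^ (m : ℤ) - σ ^ (-(m : ℤ)))

theorem Slist_append (m : ℕ) (X Y : List ℂ) : Slist m (X ++ Y) = Slist m X + Slist m Y := by
  simp [Slist]

theorem Slist_map_mul (m : ℕ) (c : ℂ) (X : List ℂ) :
    Slist m (X.map (fun x => c * x)) = c ^ m * Slist m X := by
  simp [Slist, Function.comp_def, mul_pow, List.sum_map_mul_left]

theorem Kconst_eq (σ : ℂ) (m : ℕ) :
    Kconst σ m = (-Complex.I) ^ m * (σ ^ m - σ⁻¹ ^ m) := by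
  simp [Kconst, ← inv_pow]

theorem prod_Icc_one_eq_prod_odd_mul_prod_even {M : Type*} [CommMonoid M] (f : ℕ → M) (s : ℕ) :
    ∏ m ∈ Finset.Icc 1 s, f m =
      (∏ m ∈ (Finset.Icc 1 s).filter (fun m => Odd m), f m) *
        ∏ n ∈ Finset.Icc 1 (s / 2), f (2 * n) := by
  rw [← Finset.prod_filter_mul_prod_filter_not (Finset.Icc 1 s) (fun m => Odd m) f]
  congr 1
  symm
  refine Finset.prod_nbij (fun n => 2 * n) ?_ ?_ ?_ (fun _ _ => rfl)
  · intro n hn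
    simp only [Finset.mem_Icc, Finset.mem_filter, Nat.not_odd_iff_even] at hn ⊢
    exact ⟨by lia, even_two_mul n⟩
  · intro a _ b _ hab
    simpa using hab
  · intro m hm
    simp only [Finset.coe_filter, Finset.mem_Icc, Nat.not_odd_iff_even, Set.mem_ofPred_eq] at hm
    obtain ⟨hm, n, rfl⟩ := hm
    exact ⟨n, by simp only [Finset.coe_Icc, Set.mem_Icc]; lia, two_mul n⟩

/-- relation between the kink-sector and breather-sector solutions: for
nonzero `σ` and a partition `h` with `K_m ≠ 0` whenever `k_m > 0`, and any tuples
`X_-`, `X_+` with union `X`: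
`Q^h(((−iσx)_{x∈X}) ∪ ((iσ⁻¹x)_{x∈X}) | ((σ⁻¹x)_{x∈X_-}) ∪ ((σx)_{x∈X_+}))
  = K_h · P^h(X_- | X_+)`, where `K_h = ∏_{m=1}^s K_m^{k_m}`. -/
theorem stmt14 (σ : ℂ) (hσ : σ ≠ 0) (k : ℕ → ℕ) (s : ℕ)
    (hK : ∀ m ∈ Finset.Icc 1 s, 0 < k m → Kconst σ m ≠ 0)
    (Xm Xp : List ℂ) :
    Qlist k s
      (((Xm ++ Xp).map (fun x => -Complex.I * σ * x)) ++
        ((Xm ++ Xp).map (fun x => Complex.I * σ⁻¹ * x)))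
      ((Xm.map (fun x => σ⁻¹ * x)) ++ (Xp.map (fun x => σ * x)))
    = (∏ m ∈ Finset.Icc 1 s, Kconst σ m ^ k m) * Plist k s Xm Xp := by
  simp only [Plist, Qlist, ← Finset.prod_mul_distrib, ← mul_pow]
  rw [prod_Icc_one_eq_prod_odd_mul_prod_even _ s]
  congr 1
  · refine Finset.prod_congr rfl fun m hm => ?_
    have hodd : Odd m := (Finset.mem_filter.mp hm).2
    congr 1
    simp only [Slist_append, Slist_map_mul, Kconst_eq, mul_pow, hodd.neg_pow, one_pow]
    ring
  · refine Finset.prod_congr rfl fun n hn => ?_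
    obtain ⟨j, rfl⟩ := Nat.exists_eq_add_of_le' (Finset.mem_Icc.mp hn).1
    have hI : Complex.I ^ (2 * (j + 1)) = -(-1) ^ j := by
      rw [pow_mul, Complex.I_sq, pow_succ, mul_neg_one]
    congr 1
    simp only [Slist_append, Slist_map_mul, Kconst_eq, mul_pow, (even_two_mul (j + 1)).neg_pow,
      one_pow, hI, Nat.add_sub_cancel]
    ring
end
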